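/- arXiv:1811.04575 — 6 statements merged into one kernel-verified Lean document; each statement's English description precedes it below -/
import Mathlib

section
/- Let κ > 0 be a uniform bound such that ‖g0‖ ≤ κ and ‖xAy‖ ≤ κ for all x ∈ X, y ∈ Y. Then for every g0 with ‖g0‖ ≤ κ and all s0, s1 ∈ (0,1], |V⁺_NADC(s0,g0) − V⁺_NADC(s1,g0)| ≤ 2κ|s0−s1| and |V⁻_NADC(s0,g0) − V⁻_NADC(s1,g0)| ≤ 2κ|s0−s1|; in particular V⁺_NADC(·,g0) and V⁻_NADC(·,g0) extend uniquely to 2κ-Lipschitz functions on [0,1]. -/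
open MeasureTheory Set

noncomputable section

/-- Euclidean space `ℝ^n`. -/
abbrev Euc (n : ℕ) := EuclideanSpace ℝ (Fin n)

/-- Measurable controls with values in the set `X`. -/
def Control {n : ℕ} (X : Set (Euc n)) : Type :=
  {x : ℝ → Euc n // Measurable x ∧ ∀ t, x t ∈ X}

/-- `x` and `y` coincide almost everywhere on `[s0, t]`. -/
def AEEqOn {E : Type*} (s0 t : ℝ) (x y : ℝ → E) : Prop :=
  ∀ᵐ s ∂(volume.restrict (Icc s0 t)), x s = y s

/-- The bilinear vector payoff `xAy = ∑_{i,j} x_i y_j A_{ij} ∈ ℝ^d`. -/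
def pay {a b d : ℕ} (A : Fin a → Fin b → Euc d) (x : Euc a) (y : Euc b) : Euc d :=
  ∑ i, ∑ j, (x i * y j) • A i j

/-- The solution `g^{s0,g0,x,y}(s) = (s0/s) g0 + (1/s) ∫_{s0}^s x(t) A y(t) dt` of the
averaging dynamics `g' = (1/s)(x A y − g)`, `g(s0) = g0`. -/
def traj {a b d : ℕ} (A : Fin a → Fin b → Euc d) (s0 : ℝ) (g0 : Euc d)
    (x : ℝ → Euc a) (y : ℝ → Euc b) (s : ℝ) : Euc d :=
  (s0 / s) • g0 + s⁻¹ • ∫ t in s0..s, pay A (x t) (y t)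

/-- Nonanticipative with delay piecewise-constant (NADC) strategies with grid parameter `N`:
the produced control is constant on each `[m/N, (m+1)/N)` and the strategy is
nonanticipative with delay `1/N`. -/
def IsNADCWith {m n : ℕ} {Y : Set (Euc m)} {X : Set (Euc n)}
    (s0 : ℝ) (N : ℕ) (α : Control Y → Control X) : Prop :=
  0 < N ∧
    (∀ y : Control Y, ∀ k < N, ∃ c, ∀ s ∈ Ico ((k : ℝ) / N) ((k + 1 : ℝ) / N), (α y).1 s = c) ∧
    (∀ k < N, ∀ y y' : Control Y, AEEqOn s0 ((k : ℝ) / N) y.1 y'.1 →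
      AEEqOn s0 ((k + 1 : ℝ) / N) (α y).1 (α y').1)

/-- NADC strategies. -/
def IsNADC {m n : ℕ} {Y : Set (Euc m)} {X : Set (Euc n)}
    (s0 : ℝ) (α : Control Y → Control X) : Prop :=
  ∃ N : ℕ, IsNADCWith s0 N α

/-- The upper value in NADC strategies,
`V⁺(s0,g0) = inf_α sup_y d(g^{s0,g0,α(y),y}(1), E)`. -/
def VplusNADC {a b d : ℕ} (X : Set (Euc a)) (Y : Set (Euc b))
    (A : Fin a → Fin b → Euc d) (E : Set (Euc d)) (s0 : ℝ) (g0 : Euc d) : ℝ :=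
  ⨅ α : {α : Control Y → Control X // IsNADC s0 α},
    ⨆ y : Control Y, Metric.infDist (traj A s0 g0 (α.1 y).1 y.1 1) E

/-- The lower value in NADC strategies,
`V⁻(s0,g0) = sup_β inf_x d(g^{s0,g0,x,β(x)}(1), E)`. -/
def VminusNADC {a b d : ℕ} (X : Set (Euc a)) (Y : Set (Euc b))
    (A : Fin a → Fin b → Euc d) (E : Set (Euc d)) (s0 : ℝ) (g0 : Euc d) : ℝ :=
  ⨆ β : {β : Control X → Control Y // IsNADC s0 β},
    ⨅ x : Control X, Metric.infDist (traj A s0 g0 x.1 (β.1 x).1 1) E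

lemma pay_meas {a b d : ℕ} (A : Fin a → Fin b → Euc d) (x : ℝ → Euc a) (y : ℝ → Euc b)
    (hx : Measurable x) (hy : Measurable y) : Measurable (fun t => pay A (x t) (y t)) := by
  unfold pay
  have h1 : ∀ i, Measurable (fun t => x t i) := fun i =>
    (EuclideanSpace.proj i : Euc a →L[ℝ] ℝ).continuous.measurable.comp hx
  have h2 : ∀ i, Measurable (fun t => y t i) := fun i =>
    (EuclideanSpace.proj i : Euc b →L[ℝ] ℝ).continuous.measurable.comp hy
  refine Finset.measurable_fun_sum _ fun i _ => Finset.measurable_fun_sum _ fun j _ => ?_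
  exact ((h1 i).mul (h2 j)).smul_const _

lemma pay_ii {a b d : ℕ} {X : Set (Euc a)} {Y : Set (Euc b)} (A : Fin a → Fin b → Euc d)
    {κ : ℝ} (hbound : ∀ x ∈ X, ∀ y ∈ Y, ‖pay A x y‖ ≤ κ) (x : Control X) (y : Control Y)
    (u v : ℝ) : IntervalIntegrable (fun t => pay A (x.1 t) (y.1 t)) volume u v := by
  refine (intervalIntegrable_const (c := κ)).mono_fun
    (pay_meas A _ _ x.2.1 y.2.1).aestronglyMeasurable ?_
  refine Filter.Eventually.of_forall fun t => ?_
  exact (hbound _ (x.2.2 t) _ (y.2.2 t)).trans (le_abs_self _)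

lemma traj_bound {a b d : ℕ} {X : Set (Euc a)} {Y : Set (Euc b)} (A : Fin a → Fin b → Euc d)
    {κ : ℝ} (hbound : ∀ x ∈ X, ∀ y ∈ Y, ‖pay A x y‖ ≤ κ) (g0 : Euc d)
    (s0 : ℝ) (x : Control X) (y : Control Y) :
    ‖traj A s0 g0 x.1 y.1 1‖ ≤ |s0| * ‖g0‖ + κ * |1 - s0| := by
  unfold traj
  refine (norm_add_le _ _).trans ?_
  gcongr
  · simp [norm_smul]
  · simp only [inv_one, one_smul]
    exact intervalIntegral.norm_integral_le_of_norm_le_const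
      fun t _ => hbound _ (x.2.2 t) _ (y.2.2 t)

lemma traj_aux {a b d : ℕ} {X : Set (Euc a)} {Y : Set (Euc b)} (A : Fin a → Fin b → Euc d)
    {κ : ℝ} (hbound : ∀ x ∈ X, ∀ y ∈ Y, ‖pay A x y‖ ≤ κ) (g0 : Euc d) (hg0 : ‖g0‖ ≤ κ)
    (s0 s1 : ℝ) (h01 : s0 ≤ s1) (h1 : s1 ≤ 1) (x x' : Control X) (y y' : Control Y)
    (hx : ∀ t, s1 ≤ t → x.1 t = x'.1 t) (hy : ∀ t, s1 ≤ t → y.1 t = y'.1 t) :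
    ‖traj A s0 g0 x.1 y.1 1 - traj A s1 g0 x'.1 y'.1 1‖ ≤ 2 * κ * |s0 - s1| := by
  unfold traj
  have e : ∫ t in s1..1, pay A (x'.1 t) (y'.1 t) = ∫ t in s1..1, pay A (x.1 t) (y.1 t) := by
    refine intervalIntegral.integral_congr fun t ht => ?_
    rw [uIcc_of_le h1] at ht
    simp only [hx t ht.1, hy t ht.1]
  rw [e, ← intervalIntegral.integral_add_adjacent_intervals
    (pay_ii A hbound x y s0 s1) (pay_ii A hbound x y s1 1)]
  have : (s0 / 1) • g0 + (1:ℝ)⁻¹ • ((∫ t in s0..s1, pay A (x.1 t) (y.1 t)) +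
      ∫ t in s1..1, pay A (x.1 t) (y.1 t)) -
      ((s1 / 1) • g0 + (1:ℝ)⁻¹ • ∫ t in s1..1, pay A (x.1 t) (y.1 t)) =
      (s0 - s1) • g0 + ∫ t in s0..s1, pay A (x.1 t) (y.1 t) := by
    simp only [div_one, inv_one, one_smul, sub_smul]
    abel
  rw [this]
  refine (norm_add_le _ _).trans ?_
  have h2 : ‖∫ t in s0..s1, pay A (x.1 t) (y.1 t)‖ ≤ κ * |s1 - s0| :=
    intervalIntegral.norm_integral_le_of_norm_le_const
      fun t _ => hbound _ (x.2.2 t) _ (y.2.2 t)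
  have h3 : ‖(s0 - s1) • g0‖ ≤ |s0 - s1| * κ := by
    rw [norm_smul, Real.norm_eq_abs]; gcongr
  rw [abs_sub_comm s1 s0] at h2
  linarith

lemma traj_diff {a b d : ℕ} {X : Set (Euc a)} {Y : Set (Euc b)} (A : Fin a → Fin b → Euc d)
    {κ : ℝ} (hbound : ∀ x ∈ X, ∀ y ∈ Y, ‖pay A x y‖ ≤ κ) (g0 : Euc d) (hg0 : ‖g0‖ ≤ κ)
    (s0 s1 : ℝ) (h0 : s0 ≤ 1) (h1 : s1 ≤ 1) (x x' : Control X) (y y' : Control Y)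
    (hx : ∀ t, s0 ≤ t → s1 ≤ t → x.1 t = x'.1 t) (hy : ∀ t, s0 ≤ t → s1 ≤ t → y.1 t = y'.1 t)
    (E : Set (Euc d)) :
    Metric.infDist (traj A s0 g0 x.1 y.1 1) E ≤
      Metric.infDist (traj A s1 g0 x'.1 y'.1 1) E + 2 * κ * |s0 - s1| := by
  refine (Metric.infDist_le_infDist_add_dist (y := traj A s1 g0 x'.1 y'.1 1)).trans ?_
  gcongr
  rw [dist_eq_norm]
  rcases le_total s0 s1 with h | h
  · exact traj_aux A hbound g0 hg0 s0 s1 h h1 x x' y y' (fun t ht => hx t (h.trans ht) ht)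
      (fun t ht => hy t (h.trans ht) ht)
  · rw [norm_sub_rev, abs_sub_comm]
    exact traj_aux A hbound g0 hg0 s1 s0 h h0 x' x y' y
      (fun t ht => (hx t ht (h.trans ht)).symm) (fun t ht => (hy t ht (h.trans ht)).symm)

/-- Concatenation of two controls at time `s`. -/
def glue {n : ℕ} {X : Set (Euc n)} (s : ℝ) (x x' : Control X) : Control X :=
  ⟨fun t => if t < s then x.1 t else x'.1 t,
    Measurable.ite measurableSet_Iio x.2.1 x'.2.1, fun t => by
      dsimp only; split_ifs; exacts [x.2.2 t, x'.2.2 t]⟩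

lemma glue_lt {n : ℕ} {X : Set (Euc n)} {s t : ℝ} (x x' : Control X) (h : t < s) :
    (glue s x x').1 t = x.1 t := if_pos h

lemma glue_ge {n : ℕ} {X : Set (Euc n)} {s t : ℝ} (x x' : Control X) (h : s ≤ t) :
    (glue s x x').1 t = x'.1 t := if_neg h.not_gt

lemma aeeq_iff {E : Type*} (s0 t : ℝ) (x y : ℝ → E) :
    AEEqOn s0 t x y ↔ ∀ᵐ s, s ∈ Icc s0 t → x s = y s :=
  ae_restrict_iff' measurableSet_Icc

lemma aeeq_glue {n : ℕ} {X : Set (Euc n)} {s0 s1 t : ℝ} (r x x' : Control X)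
    (h : AEEqOn s1 t x.1 x'.1) : AEEqOn s0 t (glue s1 r x).1 (glue s1 r x').1 := by
  rw [aeeq_iff] at h ⊢
  filter_upwards [h] with s hs hs'
  rcases lt_or_ge s s1 with h1 | h1
  · rw [glue_lt _ _ h1, glue_lt _ _ h1]
  · rw [glue_ge _ _ h1, glue_ge _ _ h1]; exact hs ⟨h1, hs'.2⟩

lemma aeeq_mono {E : Type*} {s0 s1 t : ℝ} {x y : ℝ → E} (h01 : s0 ≤ s1)
    (h : AEEqOn s0 t x y) : AEEqOn s1 t x y := by
  rw [aeeq_iff] at h ⊢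
  filter_upwards [h] with s hs hs'
  exact hs ⟨h01.trans hs'.1, hs'.2⟩

lemma transfer {m n : ℕ} {Y : Set (Euc m)} {X : Set (Euc n)} (r : Control Y) (s0 s1 : ℝ)
    (α : Control Y → Control X) (hα : IsNADC s0 α) :
    ∃ α' : Control Y → Control X, IsNADC s1 α' ∧ ∃ φ : Control Y → Control Y,
      ∀ y, (∀ t, s0 ≤ t → s1 ≤ t → (α (φ y)).1 t = (α' y).1 t) ∧
        (∀ t, s0 ≤ t → s1 ≤ t → (φ y).1 t = y.1 t) := by
  obtain ⟨N, hN, hc, hna⟩ := hα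
  rcases le_total s0 s1 with h | h
  · refine ⟨fun y => α (glue s1 r y), ⟨N, hN, fun y => hc _, ?_⟩, glue s1 r,
      fun y => ⟨fun _ _ _ => rfl, fun t _ ht => glue_ge _ _ ht⟩⟩
    intro k hk y y' hy
    exact aeeq_mono h (hna k hk _ _ (aeeq_glue r y y' hy))
  · refine ⟨fun y => glue s0 (α r) (α y), ⟨N, hN, ?_, ?_⟩, id,
      fun y => ⟨fun t ht _ => (glue_ge _ _ ht).symm, fun _ _ _ => rfl⟩⟩
    · intro y k hk
      obtain ⟨c, hcc⟩ := hc r k hk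
      obtain ⟨c', hcc'⟩ := hc y k hk
      by_cases h1 : ((k + 1 : ℝ) / N) ≤ s0
      · exact ⟨c, fun s hs => by rw [glue_lt _ _ (hs.2.trans_le h1)]; exact hcc s hs⟩
      by_cases h2 : s0 ≤ (k : ℝ) / N
      · exact ⟨c', fun s hs => by rw [glue_ge _ _ (h2.trans hs.1)]; exact hcc' s hs⟩
      push Not at h1 h2
      have hv : AEEqOn s0 ((k + 1 : ℝ) / N) (α r).1 (α y).1 := by
        refine hna k hk r y ?_
        rw [AEEqOn, Icc_eq_empty h2.not_ge]
        simp
      have : c = c' := by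
        rw [aeeq_iff] at hv
        by_contra hne
        have hsub : Ioo s0 ((k + 1 : ℝ) / N) ⊆
            {s | ¬ (s ∈ Icc s0 ((k + 1 : ℝ) / N) → (α r).1 s = (α y).1 s)} := by
          intro s hs hh
          have hs' : s ∈ Ico ((k : ℝ) / N) ((k + 1 : ℝ) / N) := ⟨(h2.trans hs.1).le, hs.2⟩
          have := hh ⟨hs.1.le, hs.2.le⟩
          rw [hcc s hs', hcc' s hs'] at this
          exact hne this
        have h0 := measure_mono_null hsub (ae_iff.1 hv)
        rw [Real.volume_Ioo, ENNReal.ofReal_eq_zero] at h0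
        linarith
      subst this
      refine ⟨c, fun s hs => ?_⟩
      rcases lt_or_ge s s0 with h3 | h3
      · rw [glue_lt _ _ h3]; exact hcc s hs
      · rw [glue_ge _ _ h3]; exact hcc' s hs
    · intro k hk y y' hy
      exact aeeq_glue _ _ _ (hna k hk y y' (aeeq_mono h hy))

lemma ext_unique (f : ℝ → ℝ) (K : ℝ) (hK : 0 < K)
    (hf : ∀ s0 ∈ Ioc (0 : ℝ) 1, ∀ s1 ∈ Ioc (0 : ℝ) 1, |f s0 - f s1| ≤ K * |s0 - s1|) :
    ∃! F : Icc (0 : ℝ) 1 → ℝ, LipschitzWith (Real.toNNReal K) F ∧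
      ∀ s (hs : s ∈ Ioc (0 : ℝ) 1), F ⟨s, hs.1.le, hs.2⟩ = f s := by
  have hL : LipschitzOnWith (Real.toNNReal K) f (Ioc 0 1) := by
    refine LipschitzOnWith.of_dist_le_mul fun x hx y hy => ?_
    rw [Real.coe_toNNReal _ hK.le]
    exact hf x hx y hy
  obtain ⟨g, hg, hfg⟩ := hL.extend_real
  refine ⟨fun s => g s, ⟨?_, fun s hs => (hfg hs).symm⟩, ?_⟩
  · exact LipschitzWith.of_dist_le_mul fun x y => hg.dist_le_mul x y
  · rintro F ⟨hF, hFf⟩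
    funext ⟨s, hs⟩
    rcases hs.1.eq_or_lt with h | h
    · subst h
      refine eq_of_forall_dist_le fun ε hε => ?_
      set t : ℝ := min 1 (ε / (2 * K)) with ht
      have ht0 : 0 < t := lt_min one_pos (by positivity)
      have ht1 : t ≤ 1 := min_le_left _ _
      have ht2 : 2 * K * t ≤ ε := by
        have : t ≤ ε / (2 * K) := min_le_right _ _
        rw [le_div_iff₀ (by positivity)] at this
        linarith
      have e1 := hF.dist_le_mul ⟨0, hs⟩ ⟨t, ht0.le, ht1⟩
      have e2 := hg.dist_le_mul t 0
      rw [Real.coe_toNNReal _ hK.le] at e1 e2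
      rw [hFf t ⟨ht0, ht1⟩, hfg ⟨ht0, ht1⟩, Subtype.dist_eq] at e1
      have e3 : dist (0:ℝ) t = t := by simp [abs_of_pos ht0]
      have e4 : dist t (0:ℝ) = t := by simp [abs_of_pos ht0]
      simp only [e3] at e1
      rw [e4] at e2
      have := dist_triangle (F ⟨0, hs⟩) (g t) (g 0)
      show dist (F ⟨0, hs⟩) (g 0) ≤ ε
      linarith
    · rw [hFf s ⟨h, hs.2⟩]
      exact hfg ⟨h, hs.2⟩

lemma const_nadc {m n : ℕ} {Y : Set (Euc m)} {X : Set (Euc n)} (hX : X.Nonempty) (s0 : ℝ) :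
    ∃ α : Control Y → Control X, IsNADC s0 α := by
  obtain ⟨x, hx⟩ := hX
  refine ⟨fun _ => ⟨fun _ => x, measurable_const, fun _ => hx⟩, 1, one_pos,
    fun _ _ _ => ⟨x, fun _ _ => rfl⟩, fun k _ y y' _ => ?_⟩
  exact Filter.Eventually.of_forall fun _ => rfl

lemma dist_bdd {a b d : ℕ} {X : Set (Euc a)} {Y : Set (Euc b)} (A : Fin a → Fin b → Euc d)
    {κ : ℝ} (hbound : ∀ x ∈ X, ∀ y ∈ Y, ‖pay A x y‖ ≤ κ) (g0 : Euc d) (E : Set (Euc d))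
    (s0 : ℝ) : ∃ C, ∀ (x : Control X) (y : Control Y),
      Metric.infDist (traj A s0 g0 x.1 y.1 1) E ≤ C := by
  refine ⟨Metric.infDist 0 E + (|s0| * ‖g0‖ + κ * |1 - s0|), fun x y => ?_⟩
  refine (Metric.infDist_le_infDist_add_dist (y := 0)).trans ?_
  gcongr
  rw [dist_zero_right]
  exact traj_bound A hbound g0 s0 x y

lemma vplus_le {a b d : ℕ} (X : Set (Euc a)) (Y : Set (Euc b))
    (hXne : X.Nonempty) (hYne : Y.Nonempty)
    (A : Fin a → Fin b → Euc d) (E : Set (Euc d))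
    (κ : ℝ) (hbound : ∀ x ∈ X, ∀ y ∈ Y, ‖pay A x y‖ ≤ κ)
    (g0 : Euc d) (hg0 : ‖g0‖ ≤ κ) (s0 s1 : ℝ) (h0 : s0 ≤ 1) (h1 : s1 ≤ 1) :
    VplusNADC X Y A E s1 g0 ≤ VplusNADC X Y A E s0 g0 + 2 * κ * |s0 - s1| := by
  obtain ⟨y0, hy0⟩ := hYne
  let r : Control Y := ⟨fun _ => y0, measurable_const, fun _ => hy0⟩
  haveI : Nonempty (Control Y) := ⟨r⟩
  haveI : Nonempty {α : Control Y → Control X // IsNADC s0 α} :=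
    let ⟨α, h⟩ := const_nadc hXne s0; ⟨⟨α, h⟩⟩
  obtain ⟨C, hC⟩ := dist_bdd A hbound g0 E s0
  rw [← sub_le_iff_le_add]
  refine le_ciInf fun ⟨α, hα⟩ => ?_
  rw [sub_le_iff_le_add]
  obtain ⟨α', hα', φ, hφ⟩ := transfer r s0 s1 α hα
  refine (ciInf_le ⟨0, ?_⟩ ⟨α', hα'⟩).trans ?_
  · rintro _ ⟨β, rfl⟩
    exact Real.iSup_nonneg fun _ => Metric.infDist_nonneg
  refine ciSup_le fun y => ?_
  have := traj_diff A hbound g0 hg0 s1 s0 h1 h0 (α' y) (α (φ y)) y (φ y)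
    (fun t a b => ((hφ y).1 t b a).symm) (fun t a b => ((hφ y).2 t b a).symm) E
  rw [abs_sub_comm] at this
  refine this.trans ?_
  gcongr
  refine le_ciSup (f := fun y => Metric.infDist (traj A s0 g0 (α y).1 y.1 1) E) ⟨C, ?_⟩ (φ y)
  rintro _ ⟨z, rfl⟩
  exact hC _ _

lemma vminus_le {a b d : ℕ} (X : Set (Euc a)) (Y : Set (Euc b))
    (hXne : X.Nonempty) (hYne : Y.Nonempty)
    (A : Fin a → Fin b → Euc d) (E : Set (Euc d))
    (κ : ℝ) (hbound : ∀ x ∈ X, ∀ y ∈ Y, ‖pay A x y‖ ≤ κ)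
    (g0 : Euc d) (hg0 : ‖g0‖ ≤ κ) (s0 s1 : ℝ) (h0 : s0 ≤ 1) (h1 : s1 ≤ 1) :
    VminusNADC X Y A E s0 g0 ≤ VminusNADC X Y A E s1 g0 + 2 * κ * |s0 - s1| := by
  obtain ⟨x0, hx0⟩ := hXne
  let r : Control X := ⟨fun _ => x0, measurable_const, fun _ => hx0⟩
  haveI : Nonempty (Control X) := ⟨r⟩
  haveI : Nonempty {α : Control X → Control Y // IsNADC s0 α} :=
    let ⟨α, h⟩ := const_nadc hYne s0; ⟨⟨α, h⟩⟩
  obtain ⟨C, hC⟩ := dist_bdd A hbound g0 E s1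
  have bb : ∀ (s : ℝ) (β : Control X → Control Y), BddBelow (range fun x : Control X =>
      Metric.infDist (traj A s g0 x.1 (β x).1 1) E) := by
    rintro s β
    refine ⟨0, ?_⟩
    rintro _ ⟨z, rfl⟩
    exact Metric.infDist_nonneg
  refine ciSup_le fun ⟨β, hβ⟩ => ?_
  obtain ⟨β', hβ', φ, hφ⟩ := transfer r s0 s1 β hβ
  have key : (⨅ x : Control X, Metric.infDist (traj A s0 g0 x.1 (β x).1 1) E) ≤
      (⨅ x : Control X, Metric.infDist (traj A s1 g0 x.1 (β' x).1 1) E) + 2 * κ * |s0 - s1| := by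
    rw [← sub_le_iff_le_add]
    refine le_ciInf fun x => ?_
    rw [sub_le_iff_le_add]
    exact (ciInf_le (bb s0 β) (φ x)).trans (traj_diff A hbound g0 hg0 s0 s1 h0 h1 (φ x) x
      (β (φ x)) (β' x) (hφ x).2 (hφ x).1 E)
  refine key.trans ?_
  gcongr
  refine le_ciSup (f := fun β : {β : Control X → Control Y // IsNADC s1 β} =>
    ⨅ x : Control X, Metric.infDist (traj A s1 g0 x.1 (β.1 x).1 1) E) ⟨C, ?_⟩ ⟨β', hβ'⟩
  rintro _ ⟨⟨γ, hγ⟩, rfl⟩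
  exact (ciInf_le (bb s1 γ) r).trans (hC _ _)

/-- If `‖g0‖ ≤ κ` and `‖xAy‖ ≤ κ` on `X × Y`, then `V⁺_NADC(·,g0)` and
`V⁻_NADC(·,g0)` are `2κ`-Lipschitz on `(0,1]` and extend uniquely to `2κ`-Lipschitz functions
on `[0,1]`. -/
theorem statement1 {a b d : ℕ} (X : Set (Euc a)) (Y : Set (Euc b))
    (hXc : IsCompact X) (hXconv : Convex ℝ X) (hXne : X.Nonempty)
    (hYc : IsCompact Y) (hYconv : Convex ℝ Y) (hYne : Y.Nonempty)
    (A : Fin a → Fin b → Euc d) (E : Set (Euc d)) (hE : IsClosed E)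
    (κ : ℝ) (hκ : 0 < κ) (hbound : ∀ x ∈ X, ∀ y ∈ Y, ‖pay A x y‖ ≤ κ)
    (g0 : Euc d) (hg0 : ‖g0‖ ≤ κ) :
    (∀ s0 ∈ Ioc (0 : ℝ) 1, ∀ s1 ∈ Ioc (0 : ℝ) 1,
      |VplusNADC X Y A E s0 g0 - VplusNADC X Y A E s1 g0| ≤ 2 * κ * |s0 - s1| ∧
      |VminusNADC X Y A E s0 g0 - VminusNADC X Y A E s1 g0| ≤ 2 * κ * |s0 - s1|) ∧
    (∃! F : Icc (0 : ℝ) 1 → ℝ, LipschitzWith (Real.toNNReal (2 * κ)) F ∧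
      ∀ s (hs : s ∈ Ioc (0 : ℝ) 1), F ⟨s, hs.1.le, hs.2⟩ = VplusNADC X Y A E s g0) ∧
    (∃! F : Icc (0 : ℝ) 1 → ℝ, LipschitzWith (Real.toNNReal (2 * κ)) F ∧
      ∀ s (hs : s ∈ Ioc (0 : ℝ) 1), F ⟨s, hs.1.le, hs.2⟩ = VminusNADC X Y A E s g0) := by
  have hp : ∀ s0 ∈ Ioc (0 : ℝ) 1, ∀ s1 ∈ Ioc (0 : ℝ) 1,
      |VplusNADC X Y A E s0 g0 - VplusNADC X Y A E s1 g0| ≤ 2 * κ * |s0 - s1| := by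
    intro s0 h0 s1 h1
    have e1 := vplus_le X Y hXne hYne A E κ hbound g0 hg0 s0 s1 h0.2 h1.2
    have e2 := vplus_le X Y hXne hYne A E κ hbound g0 hg0 s1 s0 h1.2 h0.2
    rw [abs_sub_comm s1 s0] at e2
    rw [abs_le]; constructor <;> linarith
  have hm : ∀ s0 ∈ Ioc (0 : ℝ) 1, ∀ s1 ∈ Ioc (0 : ℝ) 1,
      |VminusNADC X Y A E s0 g0 - VminusNADC X Y A E s1 g0| ≤ 2 * κ * |s0 - s1| := by
    intro s0 h0 s1 h1
    have e1 := vminus_le X Y hXne hYne A E κ hbound g0 hg0 s0 s1 h0.2 h1.2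
    have e2 := vminus_le X Y hXne hYne A E κ hbound g0 hg0 s1 s0 h1.2 h0.2
    rw [abs_sub_comm s1 s0] at e2
    rw [abs_le]; constructor <;> linarith
  exact ⟨fun s0 h0 s1 h1 => ⟨hp s0 h0 s1 h1, hm s0 h0 s1 h1⟩,
    ext_unique _ _ (by positivity) hp, ext_unique _ _ (by positivity) hm⟩
end
end

section
/- For every s ∈ (0,1] and all g0, g0' ∈ ℝ^d, |V⁺_NADC(s,g0) − V⁺_NADC(s,g0')| ≤ s‖g0−g0'‖ and |V⁻_NADC(s,g0) − V⁻_NADC(s,g0')| ≤ s‖g0−g0'‖. Consequently, the continuous extensions of V⁺_NADC and V⁻_NADC to s = 0 satisfy that V⁺_NADC(0,g0) and V⁻_NADC(0,g0) do not depend on g0. -/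
open MeasureTheory Set

noncomputable section

lemma aux_iSup {κ : Type*} {F G : κ → ℝ} {c B : ℝ} (hc : 0 ≤ c)
    (hG : ∀ k, G k ≤ B) (h : ∀ k, F k ≤ G k + c) : ⨆ k, F k ≤ (⨆ k, G k) + c := by
  rcases isEmpty_or_nonempty κ with he | hn
  · simpa using hc
  · refine ciSup_le fun k => (h k).trans ?_
    have : G k ≤ ⨆ k, G k := le_ciSup ⟨B, by rintro _ ⟨k, rfl⟩; exact hG k⟩ k
    linarith

lemma aux_iInf {κ : Type*} {F G : κ → ℝ} {c : ℝ} (hc : 0 ≤ c)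
    (hF : ∀ k, 0 ≤ F k) (h : ∀ k, F k ≤ G k + c) : ⨅ k, F k ≤ (⨅ k, G k) + c := by
  rcases isEmpty_or_nonempty κ with he | hn
  · simpa using hc
  · rw [← sub_le_iff_le_add]
    refine le_ciInf fun k => ?_
    have : ⨅ k, F k ≤ F k := ciInf_le ⟨0, by rintro _ ⟨k, rfl⟩; exact hF k⟩ k
    linarith [h k]

lemma aux_iInf_le {κ : Type*} {F : κ → ℝ} {B : ℝ} (hB : 0 ≤ B)
    (h0 : ∀ k, 0 ≤ F k) (h : ∀ k, F k ≤ B) : ⨅ k, F k ≤ B := by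
  rcases isEmpty_or_nonempty κ with he | ⟨⟨k⟩⟩
  · simpa using hB
  · exact (ciInf_le ⟨0, by rintro _ ⟨k, rfl⟩; exact h0 k⟩ k).trans (h k)

lemma aux_pay {a b d : ℕ} {X : Set (Euc a)} {Y : Set (Euc b)}
    (hXc : IsCompact X) (hYc : IsCompact Y) (A : Fin a → Fin b → Euc d) :
    ∃ M, 0 ≤ M ∧ ∀ x ∈ X, ∀ y ∈ Y, ‖pay A x y‖ ≤ M := by
  have hc : Continuous fun p : Euc a × Euc b => pay A p.1 p.2 := by
    unfold pay
    fun_prop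
  obtain ⟨M, hM⟩ := (hXc.prod hYc).exists_bound_of_continuousOn hc.continuousOn
  exact ⟨max M 0, le_max_right _ _, fun x hx y hy => (hM (x, y) ⟨hx, hy⟩).trans (le_max_left _ _)⟩

lemma aux_bound {a b d : ℕ} {X : Set (Euc a)} {Y : Set (Euc b)}
    (hXc : IsCompact X) (hYc : IsCompact Y) (A : Fin a → Fin b → Euc d) (E : Set (Euc d))
    (s : ℝ) (g : Euc d) :
    ∃ B, 0 ≤ B ∧ ∀ (x : Control X) (y : Control Y),
      Metric.infDist (traj A s g x.1 y.1 1) E ≤ B := by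
  obtain ⟨M, hM0, hM⟩ := aux_pay hXc hYc A
  refine ⟨Metric.infDist 0 E + (‖s • g‖ + M * |1 - s|), ?_, fun x y => ?_⟩
  · have := Metric.infDist_nonneg (x := (0 : Euc d)) (s := E)
    positivity
  · refine Metric.infDist_le_infDist_add_dist (y := 0) |>.trans ?_
    gcongr
    rw [dist_zero_right]
    unfold traj
    simp only [div_one, inv_one, one_smul]
    refine (norm_add_le _ _).trans ?_
    gcongr
    exact intervalIntegral.norm_integral_le_of_norm_le_const
      fun t _ => hM _ (x.2.2 t) _ (y.2.2 t)

lemma aux_lip {a b d : ℕ} (A : Fin a → Fin b → Euc d) (E : Set (Euc d))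
    (s : ℝ) (hs : 0 ≤ s) (g g' : Euc d) (x : ℝ → Euc a) (y : ℝ → Euc b) :
    Metric.infDist (traj A s g x y 1) E ≤ Metric.infDist (traj A s g' x y 1) E
      + s * ‖g - g'‖ := by
  refine (Metric.infDist_le_infDist_add_dist (y := traj A s g' x y 1)).trans ?_
  gcongr
  unfold traj
  rw [dist_add_right, dist_eq_norm, div_one, ← smul_sub, norm_smul, Real.norm_of_nonneg hs]

lemma aux_plus {a b d : ℕ} {X : Set (Euc a)} {Y : Set (Euc b)}
    (hXc : IsCompact X) (hYc : IsCompact Y) (A : Fin a → Fin b → Euc d) (E : Set (Euc d))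
    (s : ℝ) (hs : 0 ≤ s) (g g' : Euc d) :
    VplusNADC X Y A E s g ≤ VplusNADC X Y A E s g' + s * ‖g - g'‖ := by
  obtain ⟨B, hB0, hB⟩ := aux_bound hXc hYc A E s g'
  have hc : 0 ≤ s * ‖g - g'‖ := by positivity
  exact aux_iInf hc (fun α => Real.iSup_nonneg fun y => Metric.infDist_nonneg)
    fun α => aux_iSup hc (fun y => hB _ _) fun y => aux_lip A E s hs g g' _ _

lemma aux_minus {a b d : ℕ} {X : Set (Euc a)} {Y : Set (Euc b)}
    (hXc : IsCompact X) (hYc : IsCompact Y) (A : Fin a → Fin b → Euc d) (E : Set (Euc d))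
    (s : ℝ) (hs : 0 ≤ s) (g g' : Euc d) :
    VminusNADC X Y A E s g ≤ VminusNADC X Y A E s g' + s * ‖g - g'‖ := by
  obtain ⟨B, hB0, hB⟩ := aux_bound hXc hYc A E s g'
  have hc : 0 ≤ s * ‖g - g'‖ := by positivity
  exact aux_iSup hc
    (fun β => aux_iInf_le hB0 (fun x => Metric.infDist_nonneg) fun x => hB _ _)
    fun β => aux_iInf hc (fun x => Metric.infDist_nonneg) fun x => aux_lip A E s hs g g' _ _

lemma aux_tendsto {f : ℝ → ℝ} {c : ℝ} (h : ∀ s ∈ Ioc (0 : ℝ) 1, |f s| ≤ s * c) :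
    Filter.Tendsto f (nhdsWithin 0 (Ioc (0 : ℝ) 1)) (nhds 0) := by
  refine squeeze_zero_norm' (a := fun s => s * c) ?_ ?_
  · filter_upwards [self_mem_nhdsWithin] with s hs using h s hs
  · have : Filter.Tendsto (fun s : ℝ => s * c) (nhds 0) (nhds (0 * c)) :=
      (continuous_id.mul continuous_const).tendsto 0
    rw [zero_mul] at this
    exact this.mono_left nhdsWithin_le_nhds

/-- `V⁺_NADC(s,·)` and `V⁻_NADC(s,·)` are `s`-Lipschitz in the initial
condition, and consequently their continuous extensions at `s = 0` do not depend on `g0`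
(the difference `V(s,g0) − V(s,g0')` tends to `0` as `s → 0⁺`). -/
theorem statement2 {a b d : ℕ} (X : Set (Euc a)) (Y : Set (Euc b))
    (hXc : IsCompact X) (hXconv : Convex ℝ X) (hXne : X.Nonempty)
    (hYc : IsCompact Y) (hYconv : Convex ℝ Y) (hYne : Y.Nonempty)
    (A : Fin a → Fin b → Euc d) (E : Set (Euc d)) (hE : IsClosed E)
    (g0 g0' : Euc d) :
    (∀ s ∈ Ioc (0 : ℝ) 1,
      |VplusNADC X Y A E s g0 - VplusNADC X Y A E s g0'| ≤ s * ‖g0 - g0'‖ ∧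
      |VminusNADC X Y A E s g0 - VminusNADC X Y A E s g0'| ≤ s * ‖g0 - g0'‖) ∧
    Filter.Tendsto (fun s => VplusNADC X Y A E s g0 - VplusNADC X Y A E s g0')
      (nhdsWithin 0 (Ioc (0 : ℝ) 1)) (nhds 0) ∧
    Filter.Tendsto (fun s => VminusNADC X Y A E s g0 - VminusNADC X Y A E s g0')
      (nhdsWithin 0 (Ioc (0 : ℝ) 1)) (nhds 0) := by
  have key : ∀ s ∈ Ioc (0 : ℝ) 1,
      |VplusNADC X Y A E s g0 - VplusNADC X Y A E s g0'| ≤ s * ‖g0 - g0'‖ ∧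
      |VminusNADC X Y A E s g0 - VminusNADC X Y A E s g0'| ≤ s * ‖g0 - g0'‖ := by
    intro s hs
    have h1 := aux_plus hXc hYc A E s hs.1.le g0 g0'
    have h2 := aux_plus hXc hYc A E s hs.1.le g0' g0
    have h3 := aux_minus hXc hYc A E s hs.1.le g0 g0'
    have h4 := aux_minus hXc hYc A E s hs.1.le g0' g0
    rw [norm_sub_rev] at h2 h4
    constructor <;> rw [abs_le] <;> constructor <;> linarith
  exact ⟨key, aux_tendsto fun s hs => (key s hs).1, aux_tendsto fun s hs => (key s hs).2⟩
end
end

section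
/- Let κ ≥ sup_{x∈X,y∈Y}‖xAy‖ and let α ∈ 𝒜_NADC(s0) be an NADC strategy whose delay is 1/N (i.e., with parameter N in the definition of NADC strategies). Then for every n ≥ N, α induces a strategy σ_{α,n} of player 1 in the n-stage repeated game such that for every strategy τ of player 2, denoting ḡ_n the resulting average payoff, there exist a control y ∈ 𝒴(s0) (the piecewise-constant continuous-time version of player 2's actions) and a point g0* ∈ 𝒢 such that ‖ḡ_n − g^{s0,g0*,α(y),y}(1)‖ ≤ 2Nκ/n. -/
open MeasureTheory Set

noncomputable section

/-- A strategy of player 1 in the repeated game: a map from finite histories of past action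
pairs to `X`. -/
def Strat1 {a b : ℕ} (X : Set (Euc a)) : Type :=
  {σ : List (Euc a × Euc b) → Euc a // ∀ h, σ h ∈ X}

/-- A strategy of player 2 in the repeated game. -/
def Strat2 {a b : ℕ} (Y : Set (Euc b)) : Type :=
  {τ : List (Euc a × Euc b) → Euc b // ∀ h, τ h ∈ Y}

/-- The history of play generated by a pair of strategies after `m` stages. -/
def hist {a b : ℕ} (σ : List (Euc a × Euc b) → Euc a) (τ : List (Euc a × Euc b) → Euc b) :
    ℕ → List (Euc a × Euc b)
  | 0 => []
  | m + 1 => hist σ τ m ++ [(σ (hist σ τ m), τ (hist σ τ m))]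

/-- The average payoff `ḡ_n = (1/n) ∑_{m=1}^n x_m A y_m` generated by a pair of strategies. -/
def avgPay {a b d : ℕ} (A : Fin a → Fin b → Euc d)
    (σ : List (Euc a × Euc b) → Euc a) (τ : List (Euc a × Euc b) → Euc b) (n : ℕ) : Euc d :=
  (n : ℝ)⁻¹ • ((hist σ τ n).map fun p => pay A p.1 p.2).sum

/-- The range `𝒢 = {xAy : x ∈ X, y ∈ Y}` of the payoff. -/
def payRange {a b d : ℕ} (X : Set (Euc a)) (Y : Set (Euc b))
    (A : Fin a → Fin b → Euc d) : Set (Euc d) :=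
  {g | ∃ x ∈ X, ∃ y ∈ Y, g = pay A x y}

lemma pay_cont {a b d : ℕ} (A : Fin a → Fin b → Euc d) :
    Continuous (fun p : Euc a × Euc b => pay A p.1 p.2) := by
  unfold pay
  fun_prop

def payL {a b d : ℕ} (A : Fin a → Fin b → Euc d) (x : Euc a) : Euc b →L[ℝ] Euc d :=
  LinearMap.toContinuousLinearMap
    { toFun := fun y => pay A x y
      map_add' := by
        intro y z
        simp only [pay, PiLp.add_apply, mul_add, add_smul, Finset.sum_add_distrib]
      map_smul' := by
        intro c y
        simp only [pay, PiLp.smul_apply, smul_eq_mul, RingHom.id_apply, Finset.smul_sum, smul_smul]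
        refine Finset.sum_congr rfl fun i _ => Finset.sum_congr rfl fun j _ => ?_
        congr 1
        ring }

lemma payL_apply {a b d : ℕ} (A : Fin a → Fin b → Euc d) (x : Euc a) (y : Euc b) :
    payL A x y = pay A x y := rfl

lemma hist_eq {a b : ℕ} (σ : List (Euc a × Euc b) → Euc a) (τ : List (Euc a × Euc b) → Euc b)
    (m : ℕ) : hist σ τ m =
      (List.range m).map (fun i => (σ (hist σ τ i), τ (hist σ τ i))) := by
  induction m with
  | zero => rfl
  | succ m ih => rw [List.range_succ, List.map_append, ← ih]; rfl

lemma step_meas {E : Type*} [MeasurableSpace E] (n : ℕ) (F : ℕ → E) :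
    Measurable (fun t : ℝ => F ⌊(n : ℝ) * t⌋₊) := by
  have h1 : Measurable F := measurable_from_top
  exact h1.comp (Nat.measurable_floor.comp (measurable_const.mul measurable_id))

lemma step_integral {d : ℕ} (n : ℕ) (hn : 0 < n) (F : ℕ → Euc d) :
    (∫ t in (0:ℝ)..1, F ⌊(n : ℝ) * t⌋₊) = (n : ℝ)⁻¹ • ∑ m ∈ Finset.range n, F m := by
  have hn' : (0:ℝ) < n := by exact_mod_cast hn
  have key : ∀ m : ℕ, EqOn (fun t : ℝ => F ⌊(n : ℝ) * t⌋₊) (fun _ => F m)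
      (Ioo ((m:ℝ)/n) (((m+1 : ℕ):ℝ)/n)) := by
    intro m t ht
    have h1 : (m:ℝ) < t * n := (div_lt_iff₀ hn').1 ht.1
    have h2 : t * n < ((m+1 : ℕ):ℝ) := (lt_div_iff₀ hn').1 ht.2
    have : ⌊(n : ℝ) * t⌋₊ = m := by
      rw [Nat.floor_eq_iff (by nlinarith [(Nat.cast_nonneg m : (0:ℝ) ≤ m)])]
      push_cast at h2
      constructor <;> nlinarith
    simp only [this]
  have hle : ∀ m : ℕ, (m:ℝ)/n ≤ ((m+1 : ℕ):ℝ)/n := fun m => by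
    push_cast; gcongr; linarith
  have hint : ∀ m : ℕ, (∫ t in ((m:ℝ)/n)..(((m+1 : ℕ):ℝ)/n), F ⌊(n : ℝ) * t⌋₊)
      = (n : ℝ)⁻¹ • F m := by
    intro m
    rw [intervalIntegral.integral_of_le (hle m), integral_Ioc_eq_integral_Ioo,
      setIntegral_congr_fun measurableSet_Ioo (key m), ← integral_Ioc_eq_integral_Ioo,
      ← intervalIntegral.integral_of_le (hle m), intervalIntegral.integral_const]
    congr 1
    push_cast
    field_simp
    ring
  have hii : ∀ m < n, IntervalIntegrable (fun t : ℝ => F ⌊(n : ℝ) * t⌋₊) volume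
      ((m:ℝ)/n) (((m+1 : ℕ):ℝ)/n) := by
    intro m _
    rw [intervalIntegrable_iff_integrableOn_Ioo_of_le (hle m)]
    exact (integrableOn_congr_fun (key m) measurableSet_Ioo).2 (by simp)
  have := intervalIntegral.sum_integral_adjacent_intervals (a := fun m : ℕ => (m:ℝ)/n) hii
  simp only [hint] at this
  rw [Finset.smul_sum, this]
  simp [hn'.ne']

/-- step control -/
def stepC {b : ℕ} {Y : Set (Euc b)} (n : ℕ) (u : ℕ → Y) : Control Y :=
  ⟨fun t => (u ⌊(n : ℝ) * t⌋₊ : Euc b), step_meas n (fun i => (u i : Euc b)), fun _ => (u _).2⟩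

open Classical in
/-- action sequence read from a history -/
def actSeq {a b : ℕ} {Y : Set (Euc b)} (y0 : Y) (h : List (Euc a × Euc b)) (i : ℕ) : Y :=
  if hy : (h.getD i (0, (y0 : Euc b))).2 ∈ Y then ⟨_, hy⟩ else y0

open Classical in
/-- the induced strategy -/
def sigA {a b : ℕ} {X : Set (Euc a)} {Y : Set (Euc b)} (x0 : X) (y0 : Y) (s0 : ℝ) (n : ℕ)
    (α : Control Y → Control X) : Strat1 (b := b) X :=
  ⟨fun h => if (h.length : ℝ) / n < s0 then x0
    else (α (stepC n (actSeq y0 h))).1 ((h.length : ℝ) / n),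
   fun h => by
    beta_reduce
    split_ifs
    · exact x0.2
    · exact (α _).2.2 _⟩

lemma nadc_agree {a b : ℕ} {X : Set (Euc a)} {Y : Set (Euc b)} {s0 : ℝ} {N : ℕ}
    {α : Control Y → Control X} (hα : IsNADCWith s0 N α) {k : ℕ} (hk : k < N)
    {y y' : Control Y} (h : AEEqOn s0 ((k : ℝ) / N) y.1 y'.1)
    (hs : s0 < (k + 1 : ℝ) / N) {s t : ℝ}
    (hsm : s ∈ Ico ((k : ℝ) / N) ((k + 1 : ℝ) / N))
    (htm : t ∈ Ico ((k : ℝ) / N) ((k + 1 : ℝ) / N)) : (α y).1 s = (α y').1 t := by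
  obtain ⟨_, h1, h2⟩ := hα
  obtain ⟨c, hc⟩ := h1 y k hk
  obtain ⟨c', hc'⟩ := h1 y' k hk
  rw [hc s hsm, hc' t htm]
  have h3 := h2 k hk y y' h
  unfold AEEqOn at h3
  by_contra hne
  have hsub : Ico (max s0 ((k:ℝ)/N)) ((k + 1 : ℝ) / N) ⊆ Icc s0 ((k + 1 : ℝ) / N) :=
    fun r hr => ⟨(le_max_left _ _).trans hr.1, hr.2.le⟩
  have h4 := ae_restrict_of_ae_restrict_of_subset hsub h3
  rw [ae_restrict_iff' measurableSet_Ico] at h4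
  have h5 : ∀ᵐ r : ℝ, r ∉ Ico (max s0 ((k:ℝ)/N)) ((k + 1 : ℝ) / N) := by
    filter_upwards [h4] with r hr hm
    have := hr hm
    have hr' : r ∈ Ico ((k : ℝ) / N) ((k + 1 : ℝ) / N) := ⟨(le_max_right _ _).trans hm.1, hm.2⟩
    rw [hc r hr', hc' r hr'] at this
    exact hne this
  have h6 : volume (Ico (max s0 ((k:ℝ)/N)) ((k + 1 : ℝ) / N)) = 0 := by
    rw [← compl_mem_ae_iff]; exact h5
  rw [Real.volume_Ico, ENNReal.ofReal_eq_zero] at h6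
  have h7 : max s0 ((k:ℝ)/N) < (k + 1 : ℝ) / N := max_lt hs (hsm.1.trans_lt hsm.2)
  linarith

/-- An NADC strategy `α` with delay `1/N` induces, in every `n`-stage
repeated game with `n ≥ N`, a strategy `σ_{α,n}` such that against every strategy `τ` of
player 2 there are a control `y` and a point `g0* ∈ 𝒢` with
`‖ḡ_n − g^{s0,g0*,α(y),y}(1)‖ ≤ 2Nκ/n`. -/
theorem statement4 {a b d : ℕ} (X : Set (Euc a)) (Y : Set (Euc b))
    (hXc : IsCompact X) (hXconv : Convex ℝ X) (hXne : X.Nonempty)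
    (hYc : IsCompact Y) (hYconv : Convex ℝ Y) (hYne : Y.Nonempty)
    (A : Fin a → Fin b → Euc d)
    (κ : ℝ) (hκ : ∀ x ∈ X, ∀ y ∈ Y, ‖pay A x y‖ ≤ κ)
    (s0 : ℝ) (hs0 : s0 ∈ Ioc (0 : ℝ) 1)
    (N : ℕ) (α : Control Y → Control X) (hα : IsNADCWith s0 N α) :
    ∀ n : ℕ, N ≤ n → ∃ σ : Strat1 X, ∀ τ : Strat2 Y,
      ∃ (y : Control Y) (g0s : Euc d), g0s ∈ payRange X Y A ∧
        ‖avgPay A σ.1 τ.1 n - traj A s0 g0s (α y).1 y.1 1‖ ≤ 2 * N * κ / n := by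
  intro n hNn
  obtain ⟨x0, hx0⟩ := hXne
  obtain ⟨y0, hy0⟩ := hYne
  have hN : 0 < N := hα.1
  have hn : 0 < n := hN.trans_le hNn
  have hN' : (0:ℝ) < N := by exact_mod_cast hN
  have hn' : (0:ℝ) < n := by exact_mod_cast hn
  have hκ0 : 0 ≤ κ := (norm_nonneg _).trans (hκ x0 hx0 y0 hy0)
  obtain ⟨hs0p, hs01⟩ := hs0
  set σ : Strat1 (b := b) X := sigA ⟨x0, hx0⟩ ⟨y0, hy0⟩ s0 n α with hσ
  refine ⟨σ, fun τ => ?_⟩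
  set H := hist σ.1 τ.1 with hH
  have hlen : ∀ m, (H m).length = m := fun m => by rw [hH, hist_eq]; simp
  set u : ℕ → Y := actSeq ⟨y0, hy0⟩ (H n) with hu
  have hact : ∀ m i, i < m → (actSeq (Y := Y) ⟨y0, hy0⟩ (H m) i : Euc b) = τ.1 (H i) := by
    intro m i him
    have : (H m).getD i (0, y0) = (σ.1 (H i), τ.1 (H i)) := by
      rw [hH, hist_eq]; simp [him]
    have hmem : ((H m).getD i (0, y0)).2 ∈ Y := by rw [this]; exact τ.2 _
    unfold actSeq
    rw [dif_pos hmem]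
    exact congrArg Prod.snd this
  set y : Control Y := stepC n u with hy
  have hyt : ∀ t : ℝ, y.1 t = u ⌊(n : ℝ) * t⌋₊ := fun t => rfl
  have hym : Measurable y.1 := y.2.1
  -- average payoff as an integral
  set xt : ℝ → Euc a := fun t => σ.1 (H ⌊(n : ℝ) * t⌋₊) with hxt
  have hxtm : Measurable xt := step_meas n (fun i => σ.1 (H i))
  have havg : avgPay A σ.1 τ.1 n = ∫ t in (0:ℝ)..1, pay A (xt t) (y.1 t) := by
    have h1 := step_integral n hn (fun m => pay A (σ.1 (H m)) (u m))
    have h2 : (∫ t in (0:ℝ)..1, pay A (xt t) (y.1 t)) =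
      ∫ t in (0:ℝ)..1, (fun m => pay A (σ.1 (H m)) (u m)) ⌊(n : ℝ) * t⌋₊ := rfl
    rw [h2, h1, avgPay, hist_eq, List.map_map, ← List.sum_toFinset _ List.nodup_range,
      List.toFinset_range]
    congr 1
    refine Finset.sum_congr rfl fun i hi => ?_
    rw [hu, hact n i (Finset.mem_range.1 hi)]
    rfl
  -- integrability
  have hint : ∀ (x : ℝ → Euc a), Measurable x → (∀ t, x t ∈ X) → ∀ p q : ℝ,
      IntervalIntegrable (fun t => pay A (x t) (y.1 t)) volume p q := by
    intro x hx hxX p q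
    rw [intervalIntegrable_iff]
    refine Measure.integrableOn_of_bounded (M := κ) ?_ ?_ ?_
    · simp
    · exact ((pay_cont A).measurable.comp (hx.prodMk hym)).aestronglyMeasurable
    · exact Filter.Eventually.of_forall fun t => hκ _ (hxX t) _ (y.2.2 t)
  have hxtX : ∀ t, xt t ∈ X := fun t => σ.2 _
  -- the initial point
  have hflo : ∀ t : ℝ, 0 ≤ t → (⌊(n : ℝ) * t⌋₊ : ℝ) / n ≤ t := by
    intro t ht
    rw [div_le_iff₀ hn', mul_comm t]
    exact Nat.floor_le (by positivity)
  have hflo2 : ∀ t : ℝ, t < (⌊(n : ℝ) * t⌋₊ : ℝ) / n + 1 / n := by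
    intro t
    rw [← add_div, lt_div_iff₀ hn', mul_comm t]
    exact Nat.lt_floor_add_one _
  have hσlt : ∀ m : ℕ, (m : ℝ) / n < s0 → σ.1 (H m) = x0 := by
    intro m hm
    simp only [hσ, sigA]
    rw [if_pos]
    rwa [hlen]
  have hσge : ∀ m : ℕ, ¬ (m : ℝ) / n < s0 →
      σ.1 (H m) = (α (stepC n (actSeq ⟨y0, hy0⟩ (H m)))).1 ((m : ℝ) / n) := by
    intro m hm
    conv_lhs => simp only [hσ, sigA]
    rw [if_neg (by rwa [hlen]), hlen]
  have hyint : IntegrableOn y.1 (Ioc 0 s0) volume := by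
    obtain ⟨M, hM⟩ := hYc.isBounded.exists_norm_le
    refine Measure.integrableOn_of_bounded (M := M) ?_ ?_ ?_
    · simp
    · exact hym.aestronglyMeasurable
    · exact Filter.Eventually.of_forall fun t => hM _ (y.2.2 t)
  have hvol : volume (Ioc (0:ℝ) s0) = ENNReal.ofReal s0 := by simp
  set z : Euc b := ⨍ t in Ioc 0 s0, y.1 t with hz
  have hzY : z ∈ Y := by
    refine hYconv.set_average_mem hYc.isClosed ?_ ?_ ?_ hyint
    · rw [hvol]; simpa using hs0p
    · rw [hvol]; simp
    · exact Filter.Eventually.of_forall fun t => y.2.2 t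
  have hfirst : (∫ t in (0:ℝ)..s0, pay A (xt t) (y.1 t)) = s0 • pay A x0 z := by
    rw [intervalIntegral.integral_of_le hs0p.le, integral_Ioc_eq_integral_Ioo]
    have : EqOn (fun t => pay A (xt t) (y.1 t)) (fun t => payL A x0 (y.1 t)) (Ioo 0 s0) := by
      intro t ht
      simp only [payL_apply]
      rw [hxt]
      simp only
      rw [hσlt _ ((hflo t ht.1.le).trans_lt ht.2)]
    rw [setIntegral_congr_fun measurableSet_Ioo this, ← integral_Ioc_eq_integral_Ioo,
      ContinuousLinearMap.integral_comp_comm _ hyint, ← payL_apply, ← map_smul, hz,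
      setAverage_eq]
    congr 1
    simp [Measure.real, hs0p.le, smul_smul, hs0p.ne']
  refine ⟨y, pay A x0 z, ⟨x0, hx0, z, hzY, rfl⟩, ?_⟩
  have hαX : ∀ t, (α y).1 t ∈ X := (α y).2.2
  have hαm : Measurable (α y).1 := (α y).2.1
  have hdiff : avgPay A σ.1 τ.1 n - traj A s0 (pay A x0 z) (α y).1 y.1 1 =
      ∫ t in s0..1, (pay A (xt t) (y.1 t) - pay A ((α y).1 t) (y.1 t)) := by
    rw [havg, traj, intervalIntegral.integral_sub (hint _ hxtm hxtX _ _) (hint _ hαm hαX _ _),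
      ← intervalIntegral.integral_add_adjacent_intervals (hint _ hxtm hxtX 0 s0)
        (hint _ hxtm hxtX s0 1), hfirst]
    simp
  rw [hdiff]
  -- good times
  set p : ℕ → ℝ := fun k => if k = 0 then s0 else (k:ℝ) / N with hp
  have hgood : ∀ t ∈ Ico s0 1, (∀ k < N, t ∉ Ico (p k) (p k + 1 / n)) →
      xt t = (α y).1 t := by
    intro t ht hbad
    have ht0 : 0 ≤ t := hs0p.le.trans ht.1
    set m := ⌊(n : ℝ) * t⌋₊ with hm
    have hmt : (m:ℝ)/n ≤ t := hflo t ht0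
    have htm : t < (m:ℝ)/n + 1/n := hflo2 t
    have hb : ∀ k < N, p k ≤ t → p k ≤ (m:ℝ)/n := by
      intro k hk hpk
      by_contra hlt
      push Not at hlt
      exact hbad k hk ⟨hpk, by linarith⟩
    have hms : s0 ≤ (m:ℝ)/n := by
      have := hb 0 hN
      simp only [hp, if_true] at this
      exact this ht.1
    set k := ⌊(N : ℝ) * t⌋₊ with hk
    have hkt : (k:ℝ) ≤ N * t := Nat.floor_le (by positivity)
    have htk : N * t < (k:ℝ) + 1 := Nat.lt_floor_add_one _
    have hkN : k < N := by
      have : (k:ℝ) < N := by nlinarith [ht.2]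
      exact_mod_cast this
    have hkt' : (k:ℝ)/N ≤ t := by rw [div_le_iff₀ hN']; linarith
    have htk' : t < ((k:ℝ)+1)/N := by rw [lt_div_iff₀ hN']; linarith
    have hkm : (k:ℝ)/N ≤ (m:ℝ)/n := by
      by_cases h0 : k = 0
      · rw [h0]; simp; positivity
      · have := hb k hkN
        simp only [hp, if_neg h0] at this
        exact this hkt'
    have hmn : m < n := by
      have : (m:ℝ)/n < 1 := hmt.trans_lt ht.2
      rw [div_lt_one hn'] at this
      exact_mod_cast this
    have e1 : xt t = (α (stepC n (actSeq ⟨y0, hy0⟩ (H m)))).1 ((m : ℝ) / n) :=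
      hσge m (not_lt.2 hms)
    rw [e1]
    refine nadc_agree hα hkN ?_ (ht.1.trans_lt htk') ⟨hkm, hmt.trans_lt htk'⟩ ⟨hkt', htk'⟩
    unfold AEEqOn
    rw [ae_restrict_iff' measurableSet_Icc]
    have hne : ∀ᵐ s : ℝ, s ≠ (k:ℝ)/N := by
      rw [ae_iff]; simp
    filter_upwards [hne] with s hs hsI
    have hs0' : 0 ≤ s := hs0p.le.trans hsI.1
    have hslt : s < (m:ℝ)/n := (lt_of_le_of_ne hsI.2 hs).trans_le hkm
    have hfl : ⌊(n:ℝ) * s⌋₊ < m := by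
      rw [Nat.floor_lt (by positivity)]
      rw [lt_div_iff₀ hn'] at hslt
      linarith
    change (actSeq (Y := Y) ⟨y0, hy0⟩ (H m) ⌊(n:ℝ) * s⌋₊ : Euc b) = actSeq ⟨y0, hy0⟩ (H n) ⌊(n:ℝ) * s⌋₊
    rw [hact m _ hfl, hact n _ (hfl.trans hmn)]
  -- final estimate
  set G : ℝ → ℝ := fun t => ∑ k ∈ Finset.range N,
    (Ico (p k) (p k + 1 / n)).indicator (fun _ => 2 * κ) t with hG
  have hind : ∀ k, Integrable ((Ico (p k) (p k + 1 / n)).indicator (fun _ : ℝ => 2 * κ)) volume := by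
    intro k
    rw [integrable_indicator_iff measurableSet_Ico]
    exact integrableOn_const (by simp)
  have hind0 : ∀ k t, 0 ≤ (Ico (p k) (p k + 1 / n)).indicator (fun _ : ℝ => 2 * κ) t :=
    fun k t => indicator_nonneg (fun _ _ => by positivity) t
  have hGi : Integrable G volume := integrable_finsetSum _ fun k _ => hind k
  have hG0 : ∀ t, 0 ≤ G t := fun t => Finset.sum_nonneg fun k _ => hind0 k t
  have hGint : ∫ t, G t = 2 * N * κ / n := by
    rw [hG, integral_finsetSum _ fun k _ => hind k]
    simp only [integral_indicator measurableSet_Ico, setIntegral_const]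
    simp [Measure.real, hn'.le]
    field_simp
  rw [intervalIntegral.integral_of_le hs01, integral_Ioc_eq_integral_Ioo, ← hGint]
  refine (norm_integral_le_of_norm_le hGi.integrableOn ?_).trans
    (setIntegral_le_integral hGi (Filter.Eventually.of_forall hG0))
  refine (ae_restrict_iff' measurableSet_Ioo).2 (Filter.Eventually.of_forall fun t ht => ?_)
  by_cases hbad : ∀ k < N, t ∉ Ico (p k) (p k + 1 / n)
  · rw [hgood t ⟨ht.1.le, ht.2⟩ hbad, sub_self, norm_zero]
    exact hG0 t
  · push Not at hbad
    obtain ⟨k, hk, htk⟩ := hbad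
    have h1 : ‖pay A (xt t) (y.1 t) - pay A ((α y).1 t) (y.1 t)‖ ≤ 2 * κ := by
      refine (norm_sub_le _ _).trans ?_
      have := hκ _ (hxtX t) _ (y.2.2 t)
      have := hκ _ (hαX t) _ (y.2.2 t)
      linarith
    refine h1.trans ?_
    have := Finset.single_le_sum (f := fun k => (Ico (p k) (p k + 1 / n)).indicator
      (fun _ : ℝ => 2 * κ) t) (fun k _ => hind0 k t) (Finset.mem_range.2 hk)
    simp only [indicator_of_mem htk] at this
    exact this
end
end

section
/- (Vieille's theorem.) Every closed set E ⊆ ℝ^d is either weakly approachable by player 1 or weakly excludable by player 2. -/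
open MeasureTheory Set

noncomputable section

/-- `E` is weakly approachable by player 1. -/
def WeaklyApproachable {a b d : ℕ} (X : Set (Euc a)) (Y : Set (Euc b))
    (A : Fin a → Fin b → Euc d) (E : Set (Euc d)) : Prop :=
  ∀ ε > 0, ∃ N : ℕ, ∀ n ≥ N, ∃ σ : Strat1 X, ∀ τ : Strat2 Y,
    Metric.infDist (avgPay A σ.1 τ.1 n) E ≤ ε

/-- `E` is weakly excludable by player 2: player 2 can weakly approach the complement of
some `η`-neighborhood of `E`. -/
def WeaklyExcludable {a b d : ℕ} (X : Set (Euc a)) (Y : Set (Euc b))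
    (A : Fin a → Fin b → Euc d) (E : Set (Euc d)) : Prop :=
  ∃ η > 0, ∀ ε > 0, ∃ N : ℕ, ∀ n ≥ N, ∃ τ : Strat2 Y, ∀ σ : Strat1 X,
    Metric.infDist (avgPay A σ.1 τ.1 n) (Metric.thickening η E)ᶜ ≤ ε

namespace VT

variable {a b d : ℕ}

def payR (A : Fin a → Fin b → Euc d) (x : Euc a) : Euc b →ₗ[ℝ] Euc d where
  toFun y := pay A x y
  map_add' y y' := by
    simp [pay, mul_add, add_smul, Finset.sum_add_distrib]
  map_smul' c y := by
    simp only [pay, Finset.smul_sum, smul_smul, RingHom.id_apply, PiLp.smul_apply, smul_eq_mul]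
    refine Finset.sum_congr rfl fun i _ => Finset.sum_congr rfl fun j _ => ?_
    congr 1; ring

def payLf (A : Fin a → Fin b → Euc d) (y : Euc b) : Euc a →ₗ[ℝ] Euc d where
  toFun x := pay A x y
  map_add' y y' := by
    simp [pay, add_mul, add_smul, Finset.sum_add_distrib]
  map_smul' c y := by
    simp only [pay, Finset.smul_sum, smul_smul, RingHom.id_apply, PiLp.smul_apply, smul_eq_mul]
    refine Finset.sum_congr rfl fun i _ => Finset.sum_congr rfl fun j _ => ?_
    congr 1; ring

lemma pay_cont (A : Fin a → Fin b → Euc d) :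
    Continuous fun p : Euc a × Euc b => pay A p.1 p.2 := by
  unfold pay
  fun_prop

lemma exists_bound (X : Set (Euc a)) (Y : Set (Euc b)) (hXc : IsCompact X) (hYc : IsCompact Y)
    (A : Fin a → Fin b → Euc d) :
    ∃ M : ℝ, 0 ≤ M ∧ ∀ x ∈ X, ∀ y ∈ Y, ‖pay A x y‖ ≤ M := by
  obtain ⟨C, hC⟩ := (hXc.prod hYc).exists_bound_of_continuousOn (pay_cont A).continuousOn
  exact ⟨max C 0, le_max_right _ _, fun x hx y hy => (hC (x, y) ⟨hx, hy⟩).trans (le_max_left _ _)⟩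

lemma exists_saddle (X : Set (Euc a)) (Y : Set (Euc b))
    (hXc : IsCompact X) (hXconv : Convex ℝ X) (hXne : X.Nonempty)
    (hYc : IsCompact Y) (hYconv : Convex ℝ Y) (hYne : Y.Nonempty)
    (A : Fin a → Fin b → Euc d) (s : Euc d) :
    ∃ x0 ∈ X, ∃ y0 ∈ Y, ∀ x ∈ X, ∀ y ∈ Y,
      inner ℝ s (pay A x0 y) ≤ inner ℝ s (pay A x y0) := by
  have hc := pay_cont A
  refine Sion.exists_isSaddlePointOn (f := fun x y => (inner ℝ s (pay A x y) : ℝ))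
    hXne hXconv hXc ?_ ?_ hYconv hYne hYc ?_ ?_
  · intro y _
    have : Continuous fun x => (inner ℝ s (pay A x y) : ℝ) :=
      continuous_const.inner (hc.comp (by fun_prop : Continuous fun x : Euc a => (x, y)))
    exact this.lowerSemicontinuous.lowerSemicontinuousOn _
  · intro y _
    exact ((((innerSL ℝ s).toLinearMap).comp (payLf A y)).convexOn hXconv).quasiconvexOn
  · intro x _
    have : Continuous fun y => (inner ℝ s (pay A x y) : ℝ) :=
      continuous_const.inner (hc.comp (by fun_prop : Continuous fun y : Euc b => (x, y)))
    exact this.upperSemicontinuous.upperSemicontinuousOn _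
  · intro x _
    exact ((((innerSL ℝ s).toLinearMap).comp (payR A x)).concaveOn hYconv).quasiconcaveOn

/-- Sum of payoffs along a history. -/
def tot (A : Fin a → Fin b → Euc d) (h : List (Euc a × Euc b)) : Euc d :=
  (h.map fun p => pay A p.1 p.2).sum

lemma tot_append (A : Fin a → Fin b → Euc d) (h : List (Euc a × Euc b)) (x : Euc a) (y : Euc b) :
    tot A (h ++ [(x, y)]) = tot A h + pay A x y := by
  simp [tot]

lemma hist_length (σ : List (Euc a × Euc b) → Euc a) (τ : List (Euc a × Euc b) → Euc b) (m : ℕ) :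
    (hist σ τ m).length = m := by
  induction m with
  | zero => rfl
  | succ k ih => simp [hist, ih]

/-- The informed player 1 can force the target `S` in `k` stages. -/
def Win (X : Set (Euc a)) (Y : Set (Euc b)) (A : Fin a → Fin b → Euc d) (S : Set (Euc d)) :
    ℕ → Euc d → Prop
  | 0, z => z ∈ S
  | k + 1, z => ∀ y ∈ Y, ∃ x ∈ X, Win X Y A S k (z + pay A x y)

open Classical in
lemma strat2_of_not_win (X : Set (Euc a)) (Y : Set (Euc b)) (hYne : Y.Nonempty)
    (A : Fin a → Fin b → Euc d) (S : Set (Euc d)) (n : ℕ) (h : ¬ Win X Y A S n 0) :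
    ∃ τ : Strat2 (a := a) Y, ∀ σ : Strat1 (b := b) X, tot A (hist σ.1 τ.1 n) ∉ S := by
  obtain ⟨y0, hy0⟩ := hYne
  let P : List (Euc a × Euc b) → Euc b → Prop := fun h y =>
    y ∈ Y ∧ ∀ x ∈ X, ¬ Win X Y A S (n - h.length - 1) (tot A h + pay A x y)
  let τ : List (Euc a × Euc b) → Euc b := fun h => if H : ∃ y, P h y then H.choose else y0
  have hτ : ∀ h, τ h ∈ Y := by
    intro h
    by_cases H : ∃ y, P h y
    · simp only [τ, dif_pos H]; exact H.choose_spec.1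
    · simp only [τ, dif_neg H]; exact hy0
  refine ⟨⟨τ, hτ⟩, fun σ => ?_⟩
  have key : ∀ m ≤ n, ¬ Win X Y A S (n - m) (tot A (hist σ.1 τ m)) := by
    intro m
    induction m with
    | zero => intro _; simpa [hist, tot] using h
    | succ m ih =>
      intro hm
      have h1 := ih (by omega)
      obtain ⟨k, hk⟩ : ∃ k, n - m = k + 1 := ⟨n - m - 1, by omega⟩
      have hk' : n - (m + 1) = k := by omega
      rw [hk, Win] at h1
      push Not at h1
      have H : ∃ y, P (hist σ.1 τ m) y := by
        obtain ⟨y, hy, hy'⟩ := h1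
        refine ⟨y, hy, ?_⟩
        rw [hist_length, hk]; exact hy'
      have h2 := H.choose_spec.2
      rw [hist_length, hk] at h2
      have h3 : τ (hist σ.1 τ m) = H.choose := by simp only [τ, dif_pos H]
      rw [hk', hist, tot_append, h3]
      exact h2 _ (σ.2 _)
  have := key n le_rfl
  simpa [Win] using this

open Classical in
lemma strat1_of_win (X : Set (Euc a)) (Y : Set (Euc b))
    (hXc : IsCompact X) (hXconv : Convex ℝ X) (hXne : X.Nonempty)
    (hYc : IsCompact Y) (hYconv : Convex ℝ Y) (hYne : Y.Nonempty)
    (A : Fin a → Fin b → Euc d) (M : ℝ)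
    (hM : ∀ x ∈ X, ∀ y ∈ Y, ‖pay A x y‖ ≤ M)
    (S : Set (Euc d)) (n : ℕ) (h : Win X Y A S n 0) :
    ∃ σ : Strat1 (b := b) X, ∀ τ : Strat2 (a := a) Y, ∃ w ∈ S,
      ‖tot A (hist σ.1 τ.1 n) - w‖ ^ 2 ≤ n * (2 * M) ^ 2 := by
  have hs := exists_saddle X Y hXc hXconv hXne hYc hYconv hYne A
  choose xs hxs ys hys hsad using hs
  obtain ⟨x0, hx0⟩ := hXne
  let Q : ℕ → Euc d → Euc b → Euc a → Prop := fun k w y x =>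
    x ∈ X ∧ Win X Y A S k (w + pay A x y)
  let r : ℕ → Euc d → Euc b → Euc a := fun k w y => if H : ∃ x, Q k w y x then H.choose else x0
  let step : ℕ × Euc d × Euc d → Euc a × Euc b → ℕ × Euc d × Euc d := fun t p =>
    (t.1 + 1, t.2.1 + pay A p.1 p.2,
      t.2.2 + pay A (r (n - t.1 - 1) t.2.2 (ys (t.2.1 - t.2.2))) (ys (t.2.1 - t.2.2)))
  let st : List (Euc a × Euc b) → ℕ × Euc d × Euc d := fun h => h.foldl step (0, 0, 0)
  let σ : List (Euc a × Euc b) → Euc a := fun h => xs ((st h).2.1 - (st h).2.2)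
  refine ⟨⟨σ, fun h => hxs _⟩, fun τ => ?_⟩
  have key : ∀ m ≤ n, ∃ w, st (hist σ τ.1 m) = (m, tot A (hist σ τ.1 m), w) ∧
      Win X Y A S (n - m) w ∧ ‖tot A (hist σ τ.1 m) - w‖ ^ 2 ≤ m * (2 * M) ^ 2 := by
    intro m
    induction m with
    | zero => intro _; exact ⟨0, by simp [hist, tot, st], by simpa using h, by simp [hist, tot]⟩
    | succ m ih =>
      intro hm
      obtain ⟨w, h1, h2, h3⟩ := ih (by omega)
      obtain ⟨k, hk⟩ : ∃ k, n - m = k + 1 := ⟨n - m - 1, by omega⟩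
      have hk' : n - (m + 1) = k := by omega
      set H := hist σ τ.1 m with hH
      set z := tot A H with hz
      have hσ : σ H = xs (z - w) := by simp only [σ, h1]
      rw [hk, Win] at h2
      have hex : ∃ x, Q k w (ys (z - w)) x := h2 _ (hys _)
      have hr : r k w (ys (z - w)) = hex.choose := by simp only [r, dif_pos hex]
      obtain ⟨hrX, hrW⟩ := hex.choose_spec
      rw [← hr] at hrX hrW
      have hτ := τ.2 H
      have hh : hist σ τ.1 (m + 1) = H ++ [(xs (z - w), τ.1 H)] := by
        rw [hist, ← hH, hσ]
      refine ⟨w + pay A (r k w (ys (z - w))) (ys (z - w)), ?_, ?_, ?_⟩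
      · rw [hh, tot_append]
        have : st (H ++ [(xs (z - w), τ.1 H)]) = step (st H) (xs (z - w), τ.1 H) := by
          simp [st]
        rw [this, h1]
        simp only [step, hk]
        rfl
      · rw [hk']; exact hrW
      · rw [hh, tot_append, ← hz]
        set p := pay A (xs (z - w)) (τ.1 H)
        set q := pay A (r k w (ys (z - w))) (ys (z - w))
        have e : z + p - (w + q) = (z - w) + (p - q) := by abel
        have i1 : inner ℝ (z - w) p ≤ inner ℝ (z - w) q := hsad _ _ hrX _ hτ
        have n1 : ‖p - q‖ ≤ 2 * M := by
          have := norm_sub_le p q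
          have h5 : ‖p‖ ≤ M := hM _ (hxs _) _ hτ
          have h6 : ‖q‖ ≤ M := hM _ hrX _ (hys _)
          linarith
        have n2 : ‖p - q‖ ^ 2 ≤ (2 * M) ^ 2 := pow_le_pow_left₀ (norm_nonneg _) n1 2
        rw [e, norm_add_sq_real, inner_sub_right]
        push_cast
        nlinarith
  obtain ⟨w, -, h2, h3⟩ := key n le_rfl
  rw [Nat.sub_self] at h2
  exact ⟨w, h2, h3⟩

lemma hist_eq_map (σ : List (Euc a × Euc b) → Euc a) (τ : List (Euc a × Euc b) → Euc b) (m : ℕ) :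
    hist σ τ m = (List.range m).map fun i => (σ (hist σ τ i), τ (hist σ τ i)) := by
  induction m with
  | zero => rfl
  | succ k ih => rw [hist, List.range_succ, List.map_append, ← ih]; rfl

lemma tot_hist (A : Fin a → Fin b → Euc d) (σ : List (Euc a × Euc b) → Euc a)
    (τ : List (Euc a × Euc b) → Euc b) (m : ℕ) :
    tot A (hist σ τ m) = ∑ i ∈ Finset.range m, pay A (σ (hist σ τ i)) (τ (hist σ τ i)) := by
  induction m with
  | zero => simp [hist, tot]
  | succ k ih => rw [hist, tot_append, ih, Finset.sum_range_succ]

/-- Block-compressed history. -/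
def comp (k : ℕ) (h : List (Euc a × Euc b)) : List (Euc a × Euc b) :=
  (List.range (h.length / k)).map fun j =>
    ((k : ℝ)⁻¹ • ∑ i ∈ Finset.range k, (h.getD (j * k + i) 0).1,
     (k : ℝ)⁻¹ • ∑ i ∈ Finset.range k, (h.getD (j * k + i) 0).2)

lemma sum_blocks {V : Type*} [AddCommMonoid V] (f : ℕ → V) (m k : ℕ) :
    ∑ i ∈ Finset.range (m * k), f i =
      ∑ j ∈ Finset.range m, ∑ i ∈ Finset.range k, f (j * k + i) := by
  induction m with
  | zero => simp
  | succ m ih => rw [Nat.succ_mul, Finset.sum_range_add, ih, Finset.sum_range_succ]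

lemma block_strat (X : Set (Euc a)) (Y : Set (Euc b)) (hYconv : Convex ℝ Y)
    (A : Fin a → Fin b → Euc d) (k : ℕ) (hk : 0 < k) (m : ℕ) (σ : Strat1 (b := b) X) :
    ∃ σ' : Strat1 (b := b) X, ∀ τ' : Strat2 (a := a) Y, ∃ τ : Strat2 (a := a) Y,
      tot A (hist σ'.1 τ'.1 (m * k)) = (k : ℝ) • tot A (hist σ.1 τ.1 m) := by
  have hk0 : (k : ℝ) ≠ 0 := by positivity
  refine ⟨⟨fun h => σ.1 (comp k h), fun h => σ.2 _⟩, fun τ' => ?_⟩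
  set σ' : List (Euc a × Euc b) → Euc a := fun h => σ.1 (comp k h) with hσ'
  let H := hist σ' τ'.1
  let yb : ℕ → Euc b := fun j => (k : ℝ)⁻¹ • ∑ i ∈ Finset.range k, τ'.1 (H (j * k + i))
  have hyb : ∀ j, yb j ∈ Y := by
    intro j
    simp only [yb, Finset.smul_sum]
    refine hYconv.sum_mem (fun _ _ => by positivity) (by simp [hk0]) (fun i _ => τ'.2 _)
  let τ : List (Euc a × Euc b) → Euc b := fun h => yb h.length
  have hget : ∀ N l, l < N → (H N).getD l 0 = (σ' (H l), τ'.1 (H l)) := by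
    intro N l hl
    simp only [H]
    rw [hist_eq_map σ' τ'.1 N]
    simp [List.getD, hl]
  -- compressed histories
  have hcomp : ∀ N, comp k (H N) = (List.range (N / k)).map fun j =>
      ((k : ℝ)⁻¹ • ∑ i ∈ Finset.range k, σ' (H (j * k + i)), yb j) := by
    intro N
    unfold comp
    rw [show (H N).length = N from hist_length _ _ _]
    refine List.map_congr_left fun j hj => ?_
    have hj' : j < N / k := by simpa using hj
    have hlt : ∀ i ∈ Finset.range k, j * k + i < N := by
      intro i hi
      have hi := Finset.mem_range.1 hi
      have h1 : (j + 1) * k ≤ N := (Nat.le_div_iff_mul_le hk).1 hj'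
      rw [Nat.succ_mul] at h1
      omega
    refine Prod.ext ?_ ?_
    · refine congrArg (fun v => (k : ℝ)⁻¹ • v) (Finset.sum_congr rfl fun i hi => ?_)
      rw [hget N _ (hlt i hi)]
    · refine congrArg (fun v => (k : ℝ)⁻¹ • v) (Finset.sum_congr rfl fun i hi => ?_)
      rw [hget N _ (hlt i hi)]
  have hdiv : ∀ j i, i < k → (j * k + i) / k = j := by
    intro j i hi
    rw [mul_comm, Nat.mul_add_div hk, Nat.div_eq_of_lt hi, add_zero]
  have hh : ∀ j, comp k (H (j * k)) = hist σ.1 τ j := by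
    intro j
    induction j with
    | zero => rw [hcomp]; simp [hist]
    | succ j ih =>
      rw [hist, ← ih, hcomp, hcomp, Nat.mul_div_cancel _ hk, Nat.mul_div_cancel _ hk,
        List.range_succ, List.map_append]
      congr 1
      rw [List.map_singleton]
      congr 1
      refine Prod.ext ?_ ?_
      · have : ∀ i ∈ Finset.range k, σ' (H (j * k + i)) = σ.1 (comp k (H (j * k))) := by
          intro i hi
          simp only [hσ']
          rw [hcomp, hcomp, hdiv _ _ (Finset.mem_range.1 hi), Nat.mul_div_cancel _ hk]
        simp only
        rw [Finset.sum_congr rfl this, hcomp, Nat.mul_div_cancel _ hk]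
        rw [Finset.sum_const, Finset.card_range, ← Nat.cast_smul_eq_nsmul ℝ, smul_smul,
          inv_mul_cancel₀ hk0, one_smul]
      · simp [τ]
  have hx : ∀ j i, i < k → σ' (H (j * k + i)) = σ.1 (hist σ.1 τ j) := by
    intro j i hi
    rw [← hh]
    simp only [hσ']
    rw [hcomp, hcomp, hdiv _ _ hi, Nat.mul_div_cancel _ hk]
  refine ⟨⟨τ, fun h => hyb _⟩, ?_⟩
  rw [tot_hist, tot_hist, sum_blocks, Finset.smul_sum]
  refine Finset.sum_congr rfl fun j _ => ?_
  have e1 : τ (hist σ.1 τ j) = yb j := by simp [τ, hist_length]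
  change ∑ i ∈ Finset.range k, pay A (σ' (hist σ' τ'.1 (j * k + i)))
    (τ'.1 (hist σ' τ'.1 (j * k + i))) = (k : ℝ) • pay A (σ.1 (hist σ.1 τ j)) (τ (hist σ.1 τ j))
  rw [e1]
  have e2 : ∀ i ∈ Finset.range k, pay A (σ' (hist σ' τ'.1 (j * k + i))) (τ'.1 (hist σ' τ'.1 (j * k + i)))
      = payR A (σ.1 (hist σ.1 τ j)) (τ'.1 (H (j * k + i))) := by
    intro i hi
    have := hx j i (Finset.mem_range.1 hi)
    simp only [H] at this
    rw [this]; rfl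
  rw [Finset.sum_congr rfl e2, ← map_sum]
  change _ = (k : ℝ) • payR A (σ.1 (hist σ.1 τ j)) (yb j)
  rw [← map_smul]
  simp only [yb]
  rw [smul_smul, mul_inv_cancel₀ hk0, one_smul]

lemma tot_norm_le (X : Set (Euc a)) (Y : Set (Euc b)) (A : Fin a → Fin b → Euc d) (M : ℝ)
    (hM : ∀ x ∈ X, ∀ y ∈ Y, ‖pay A x y‖ ≤ M) (σ : Strat1 (b := b) X) (τ : Strat2 (a := a) Y)
    (n : ℕ) : ‖tot A (hist σ.1 τ.1 n)‖ ≤ n * M := by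
  rw [tot_hist]
  refine (norm_sum_le_of_le _ fun i _ => hM _ (σ.2 _) _ (τ.2 _)).trans ?_
  simp

lemma tot_add_le (X : Set (Euc a)) (Y : Set (Euc b)) (A : Fin a → Fin b → Euc d) (M : ℝ)
    (hM : ∀ x ∈ X, ∀ y ∈ Y, ‖pay A x y‖ ≤ M) (σ : Strat1 (b := b) X) (τ : Strat2 (a := a) Y)
    (n r : ℕ) : ‖tot A (hist σ.1 τ.1 (n + r)) - tot A (hist σ.1 τ.1 n)‖ ≤ r * M := by
  rw [tot_hist, tot_hist, Finset.sum_range_add, add_sub_cancel_left]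
  refine (norm_sum_le_of_le _ fun i _ => hM _ (σ.2 _) _ (τ.2 _)).trans ?_
  simp

/-- A guarantee in the `m`-stage game transfers to the `n`-stage game, `n ≥ m`. -/
lemma transfer (X : Set (Euc a)) (Y : Set (Euc b)) (hYconv : Convex ℝ Y)
    (A : Fin a → Fin b → Euc d) (M : ℝ) (hM0 : 0 ≤ M)
    (hM : ∀ x ∈ X, ∀ y ∈ Y, ‖pay A x y‖ ≤ M) (E : Set (Euc d)) (ε : ℝ)
    (m : ℕ) (hm : 0 < m) (n : ℕ) (hn : m ≤ n)
    (h : ∃ σ : Strat1 (b := b) X, ∀ τ : Strat2 (a := a) Y,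
      Metric.infDist (avgPay A σ.1 τ.1 m) E ≤ ε) :
    ∃ σ : Strat1 (b := b) X, ∀ τ : Strat2 (a := a) Y,
      Metric.infDist (avgPay A σ.1 τ.1 n) E ≤ ε + 2 * M * m / n := by
  obtain ⟨σ, hσ⟩ := h
  set k := n / m with hk
  have hk0 : 0 < k := Nat.div_pos hn hm
  set r := n % m with hr
  have hrm : r < m := Nat.mod_lt _ hm
  have hnk : n = m * k + r := (Nat.div_add_mod n m).symm
  obtain ⟨σ', hσ'⟩ := block_strat X Y hYconv A k hk0 m σ
  refine ⟨σ', fun τ' => ?_⟩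
  obtain ⟨τ, hτ⟩ := hσ' τ'
  have h1 := hσ τ
  have h2 := Metric.infDist_le_infDist_add_dist (s := E) (x := avgPay A σ'.1 τ'.1 n)
    (y := avgPay A σ.1 τ.1 m)
  have h3 : dist (avgPay A σ'.1 τ'.1 n) (avgPay A σ.1 τ.1 m) ≤ 2 * M * m / n := by
    have b1 := tot_add_le X Y A M hM σ' τ' (m * k) r
    have b2 := tot_norm_le X Y A M hM σ τ m
    rw [← hnk, hτ] at b1
    change dist ((n : ℝ)⁻¹ • tot A (hist σ'.1 τ'.1 n)) ((m : ℝ)⁻¹ • tot A (hist σ.1 τ.1 m)) ≤ _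
    set u := tot A (hist σ'.1 τ'.1 n)
    set v := tot A (hist σ.1 τ.1 m)
    have hm' : (0 : ℝ) < m := by exact_mod_cast hm
    have hn' : (0 : ℝ) < n := by exact_mod_cast hm.trans_le hn
    have hnk' : (n : ℝ) = m * k + r := by exact_mod_cast hnk
    have hrm' : (r : ℝ) ≤ m := by exact_mod_cast hrm.le
    have e : (n : ℝ)⁻¹ • u - (m : ℝ)⁻¹ • v =
        (n : ℝ)⁻¹ • ((u - (k : ℝ) • v) - ((r : ℝ) / m) • v) := by
      rw [sub_sub, ← add_smul, smul_sub, smul_smul]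
      congr 2
      field_simp
      linarith
    rw [dist_eq_norm, e, norm_smul, Real.norm_of_nonneg (inv_nonneg.2 hn'.le), div_eq_inv_mul _ (n : ℝ)]
    refine mul_le_mul_of_nonneg_left ?_ (inv_nonneg.2 hn'.le)
    refine (norm_sub_le _ _).trans ?_
    rw [norm_smul, Real.norm_of_nonneg (div_nonneg (Nat.cast_nonneg _) hm'.le)]
    have b3 : (r : ℝ) / m * ‖v‖ ≤ r / m * (m * M) := mul_le_mul_of_nonneg_left b2 (by positivity)
    have b4 : (r : ℝ) / m * (m * M) = r * M := by field_simp
    have b5 : (r : ℝ) * M ≤ m * M := mul_le_mul_of_nonneg_right hrm' hM0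
    linarith
  linarith

end VT

/-- **Vieille's theorem.** Every closed set `E ⊆ ℝ^d` is either weakly
approachable by player 1 or weakly excludable by player 2. -/
theorem statement6 {a b d : ℕ} (X : Set (Euc a)) (Y : Set (Euc b))
    (hXc : IsCompact X) (hXconv : Convex ℝ X) (hXne : X.Nonempty)
    (hYc : IsCompact Y) (hYconv : Convex ℝ Y) (hYne : Y.Nonempty)
    (A : Fin a → Fin b → Euc d) (E : Set (Euc d)) (hE : IsClosed E) :
    WeaklyApproachable X Y A E ∨ WeaklyExcludable X Y A E := by
  obtain ⟨M, hM0, hM⟩ := VT.exists_bound X Y hXc hYc A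
  by_cases hex : ∃ η > 0, ∃ N : ℕ, ∀ n ≥ N, ¬ VT.Win X Y A
      {z | (n : ℝ)⁻¹ • z ∈ Metric.thickening η E} n 0
  · right
    obtain ⟨η, hη, N, hN⟩ := hex
    refine ⟨η, hη, fun ε hε => ⟨N, fun n hn => ?_⟩⟩
    obtain ⟨τ, hτ⟩ := VT.strat2_of_not_win X Y hYne A _ n (hN n hn)
    refine ⟨τ, fun σ => ?_⟩
    have : avgPay A σ.1 τ.1 n ∈ (Metric.thickening η E)ᶜ := hτ σ
    rw [Metric.infDist_zero_of_mem this]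
    exact hε.le
  · left
    push Not at hex
    intro ε hε
    obtain ⟨K, hK⟩ := exists_nat_gt (max 1 ((2 * M / (ε / 3)) ^ 2))
    obtain ⟨m, hmK, hm⟩ := hex (ε / 3) (by positivity) K
    have hKm : (K : ℝ) ≤ m := by exact_mod_cast hmK
    have hm1 : (1 : ℝ) < m := ((le_max_left _ _).trans_lt hK).trans_le hKm
    have hm2 : (2 * M / (ε / 3)) ^ 2 ≤ m := ((le_max_right _ _).trans_lt hK).le.trans hKm
    have hm0 : 0 < m := by
      have : (0 : ℝ) < m := by linarith
      exact_mod_cast this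
    have hmr : (0 : ℝ) < m := by linarith
    obtain ⟨σ, hσ⟩ := VT.strat1_of_win X Y hXc hXconv hXne hYc hYconv hYne A M hM _ m hm
    have hg : ∃ σ : Strat1 (b := b) X, ∀ τ : Strat2 (a := a) Y,
        Metric.infDist (avgPay A σ.1 τ.1 m) E ≤ ε / 3 + ε / 3 := by
      refine ⟨σ, fun τ => ?_⟩
      obtain ⟨w, hw, hb⟩ := hσ τ
      change Metric.infDist ((m : ℝ)⁻¹ • VT.tot A (hist σ.1 τ.1 m)) E ≤ _
      set z := VT.tot A (hist σ.1 τ.1 m)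
      have h1 := Metric.infDist_le_infDist_add_dist (s := E) (x := (m : ℝ)⁻¹ • z)
        (y := (m : ℝ)⁻¹ • w)
      have h2 : Metric.infDist ((m : ℝ)⁻¹ • w) E ≤ ε / 3 := by
        have hw' : (m : ℝ)⁻¹ • w ∈ Metric.thickening (ε / 3) E := hw
        obtain ⟨e, he, hd⟩ := Metric.mem_thickening_iff.1 hw'
        exact (Metric.infDist_le_dist_of_mem he).trans hd.le
      have h3 : dist ((m : ℝ)⁻¹ • z) ((m : ℝ)⁻¹ • w) ≤ ε / 3 := by
        rw [dist_eq_norm, ← smul_sub, norm_smul, Real.norm_of_nonneg (inv_nonneg.2 hmr.le),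
          inv_mul_le_iff₀ hmr]
        have hme : 0 ≤ (m : ℝ) * (ε / 3) := by positivity
        refine (sq_le_sq₀ (norm_nonneg _) hme).1 ?_
        refine hb.trans ?_
        rw [div_pow, div_le_iff₀ (by positivity)] at hm2
        nlinarith
      linarith
    obtain ⟨N, hN⟩ := exists_nat_gt (2 * M * m / (ε / 3))
    refine ⟨max N m, fun n hn => ?_⟩
    have hnm : m ≤ n := (le_max_right _ _).trans hn
    have hnN : (N : ℝ) ≤ n := by exact_mod_cast (le_max_left _ _).trans hn
    obtain ⟨σ', hσ'⟩ := VT.transfer X Y hYconv A M hM0 hM E _ m hm0 n hnm hg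
    refine ⟨σ', fun τ => (hσ' τ).trans ?_⟩
    have hn0 : (0 : ℝ) < n := by exact_mod_cast hm0.trans_le hnm
    have : 2 * M * m / n ≤ ε / 3 := by
      rw [div_le_iff₀ hn0]
      rw [div_lt_iff₀ (by positivity)] at hN
      nlinarith
    linarith
end
end

section
/- Let K be a compact subset of a Euclidean space and μ, ν ∈ Δ(K). Then the supremum of J(φ) = ∫_K φ dμ + ∫_K φ* dν over φ ∈ Ξ is achieved: there exists φ ∈ Ξ such that J(φ) = sup_{ψ∈Ξ} J(ψ). -/
open MeasureTheory Set

noncomputable section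

/-- The transform `φ*(x) = inf_{y ∈ K} ‖x − y‖² − φ(y)`. -/
def cstar {n : ℕ} (K : Set (Euc n)) (φ : Euc n → ℝ) (x : Euc n) : ℝ :=
  ⨅ y : K, (‖x - y.1‖ ^ 2 - φ y.1)

/-- The class `Ξ` of continuous functions `φ` on `K` with `φ(x*) = 0` and `φ = (φ*)*`. -/
def Xi {n : ℕ} (K : Set (Euc n)) (xstar : Euc n) : Set (Euc n → ℝ) :=
  {φ | ContinuousOn φ K ∧ φ xstar = 0 ∧ ∀ x ∈ K, cstar K (cstar K φ) x = φ x}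

/-- The Kantorovich functional `J(φ) = ∫_K φ dμ + ∫_K φ* dν`. -/
def Jfun {n : ℕ} (K : Set (Euc n)) (μ ν : Measure (Euc n)) (φ : Euc n → ℝ) : ℝ :=
  (∫ x in K, φ x ∂μ) + ∫ x in K, cstar K φ x ∂ν

open BoundedContinuousFunction

lemma aux_iInf_s8 {ι : Type*} [Nonempty ι] {a b : ι → ℝ} {ε : ℝ} (ha : BddBelow (range a))
    (hb : BddBelow (range b)) (h : ∀ i, |a i - b i| ≤ ε) : |iInf a - iInf b| ≤ ε := by
  have h1 : iInf b - ε ≤ iInf a := le_ciInf fun i => by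
    have := ciInf_le hb i
    have := abs_le.1 (h i)
    linarith
  have h2 : iInf a - ε ≤ iInf b := le_ciInf fun i => by
    have := ciInf_le ha i
    have := abs_le.1 (h i)
    linarith
  rw [abs_le]; constructor <;> linarith

lemma aux_bdd {n : ℕ} {K : Set (Euc n)} (f : K →ᵇ ℝ) (x : Euc n) :
    BddBelow (range fun y : K => ‖x - y.1‖ ^ 2 - f y) := by
  refine ⟨-‖f‖, ?_⟩
  rintro _ ⟨y, rfl⟩
  have := (abs_le.1 (f.norm_coe_le_norm y)).2
  have := sq_nonneg ‖x - y.1‖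
  simp only
  linarith

lemma aux_lip_s8 {n : ℕ} {K : Set (Euc n)} (f : K →ᵇ ℝ) {M : ℝ} (hM : ∀ x ∈ K, ‖x‖ ≤ M) (x x' : K) :
    |(⨅ y : K, (‖x.1 - y.1‖ ^ 2 - f y)) - ⨅ y : K, (‖x'.1 - y.1‖ ^ 2 - f y)|
      ≤ 4 * M * dist x x' := by
  have : Nonempty K := ⟨x⟩
  refine aux_iInf_s8 (aux_bdd f _) (aux_bdd f _) fun y => ?_
  have h1 : |‖x.1 - y.1‖ - ‖x'.1 - y.1‖| ≤ dist x x' := by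
    have := abs_norm_sub_norm_le (x.1 - y.1) (x'.1 - y.1)
    rwa [sub_sub_sub_cancel_right, ← dist_eq_norm, ← Subtype.dist_eq] at this
  have h2 : ‖x.1 - y.1‖ ≤ 2 * M := by
    have := norm_sub_le x.1 y.1
    linarith [hM _ x.2, hM _ y.2]
  have h3 : ‖x'.1 - y.1‖ ≤ 2 * M := by
    have := norm_sub_le x'.1 y.1
    linarith [hM _ x'.2, hM _ y.2]
  have e : ‖x.1 - y.1‖ ^ 2 - f y - (‖x'.1 - y.1‖ ^ 2 - f y)
      = (‖x.1 - y.1‖ + ‖x'.1 - y.1‖) * (‖x.1 - y.1‖ - ‖x'.1 - y.1‖) := by ring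
  rw [e, abs_mul, abs_of_nonneg (by positivity)]
  exact mul_le_mul (by linarith) h1 (abs_nonneg _)
    (by linarith [norm_nonneg (x.1 - y.1)])

lemma aux_cont {n : ℕ} {K : Set (Euc n)} (hK : IsCompact K) (f : K →ᵇ ℝ) :
    Continuous fun x : K => ⨅ y : K, (‖x.1 - y.1‖ ^ 2 - f y) := by
  obtain ⟨M, hM⟩ := hK.isBounded.exists_norm_le
  refine (LipschitzWith.of_dist_le_mul (K := Real.toNNReal (4 * M)) fun x x' => ?_).continuous
  rw [Real.dist_eq]
  refine (aux_lip_s8 f hM x x').trans ?_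
  gcongr
  exact Real.le_coe_toNNReal _

/-- The transform on bounded continuous functions. -/
def TT {n : ℕ} {K : Set (Euc n)} (hK : IsCompact K) (f : K →ᵇ ℝ) : K →ᵇ ℝ :=
  haveI : CompactSpace K := isCompact_iff_compactSpace.1 hK
  BoundedContinuousFunction.mkOfCompact ⟨_, aux_cont hK f⟩

lemma TT_apply {n : ℕ} {K : Set (Euc n)} (hK : IsCompact K) (f : K →ᵇ ℝ) (x : K) :
    TT hK f x = ⨅ y : K, (‖x.1 - y.1‖ ^ 2 - f y) := rfl

lemma TT_continuous {n : ℕ} {K : Set (Euc n)} (hK : IsCompact K) : Continuous (TT hK) := by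
  refine (LipschitzWith.of_dist_le_mul (K := 1) fun f g => ?_).continuous
  rw [NNReal.coe_one, one_mul, BoundedContinuousFunction.dist_le dist_nonneg]
  intro x
  have : Nonempty K := ⟨x⟩
  rw [Real.dist_eq, TT_apply, TT_apply]
  refine aux_iInf_s8 (aux_bdd f _) (aux_bdd g _) fun y => ?_
  rw [sub_sub_sub_cancel_left, ← Real.dist_eq, dist_comm]
  exact BoundedContinuousFunction.dist_coe_le_dist y

lemma cstar_eq {n : ℕ} {K : Set (Euc n)} (hK : IsCompact K) (f : K →ᵇ ℝ) {φ : Euc n → ℝ}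
    (h : ∀ y : K, φ y.1 = f y) (x : K) : cstar K φ x.1 = TT hK f x := by
  simp only [cstar, TT_apply, h]

lemma int_cont {X : Type*} [TopologicalSpace X] [MeasurableSpace X] [OpensMeasurableSpace X]
    (m : Measure X) [IsFiniteMeasure m] : Continuous fun f : X →ᵇ ℝ => ∫ x, f x ∂m := by
  refine (LipschitzWith.of_dist_le_mul (K := Real.toNNReal (m.real univ)) fun f g => ?_).continuous
  rw [Real.dist_eq, ← integral_sub (f.integrable m) (g.integrable m),
    Real.coe_toNNReal _ measureReal_nonneg, dist_eq_norm]
  exact BoundedContinuousFunction.norm_integral_le_mul_norm m (f - g)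

/-- The compact set. -/
def SS {n : ℕ} {K : Set (Euc n)} (hK : IsCompact K) (x : K) : Set (K →ᵇ ℝ) :=
  {f | f x = 0 ∧ TT hK (TT hK f) = f}

lemma SS_compact {n : ℕ} {K : Set (Euc n)} (hK : IsCompact K) (x : K) : IsCompact (SS hK x) := by
  have : CompactSpace K := isCompact_iff_compactSpace.1 hK
  obtain ⟨M, hM⟩ := hK.isBounded.exists_norm_le
  have hM0 : 0 ≤ M := (norm_nonneg _).trans (hM _ x.2)
  have key : ∀ f ∈ SS hK x, ∀ y z : K, |f y - f z| ≤ 4 * M * dist y z := by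
    intro f hf y z
    rw [← hf.2]
    exact aux_lip_s8 _ hM y z
  refine BoundedContinuousFunction.arzela_ascoli₂ (Icc (-(4 * M * (2 * M))) (4 * M * (2 * M)))
    isCompact_Icc _ ?_ ?_ ?_
  · refine IsClosed.inter (s₁ := {f : K →ᵇ ℝ | f x = 0}) ?_ ?_
    · exact isClosed_eq (continuous_eval_const x) continuous_const
    · exact isClosed_eq ((TT_continuous hK).comp (TT_continuous hK)) continuous_id
  · intro f y hf
    have h1 := key f hf y x
    rw [hf.1, sub_zero] at h1
    have h2 : dist y x ≤ 2 * M := by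
      rw [Subtype.dist_eq, dist_eq_norm]
      have := norm_sub_le y.1 x.1
      linarith [hM _ x.2, hM _ y.2]
    rw [mem_Icc, ← abs_le]
    exact h1.trans (by gcongr)
  · refine Metric.equicontinuous_of_continuity_modulus (fun t => 4 * M * t) ?_ _ ?_
    · have : Continuous fun t : ℝ => 4 * M * t := by fun_prop
      simpa using this.tendsto 0
    · intro y z f
      exact key f.1 f.2 y z

/-- The functional. -/
def JJ {n : ℕ} {K : Set (Euc n)} (hK : IsCompact K) (μ ν : Measure (Euc n)) (f : K →ᵇ ℝ) : ℝ :=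
  (∫ x, f x ∂(μ.comap ((↑) : K → Euc n))) + ∫ x, TT hK f x ∂(ν.comap ((↑) : K → Euc n))

lemma Jfun_eq {n : ℕ} {K : Set (Euc n)} (hK : IsCompact K) (μ ν : Measure (Euc n)) (f : K →ᵇ ℝ)
    {φ : Euc n → ℝ} (h : ∀ y : K, φ y.1 = f y) : Jfun K μ ν φ = JJ hK μ ν f := by
  rw [Jfun, JJ, ← integral_subtype_comap hK.measurableSet,
    ← integral_subtype_comap hK.measurableSet]
  simp only [h, cstar_eq hK f h]

lemma Xi_iff {n : ℕ} {K : Set (Euc n)} (hK : IsCompact K) (x : K) (f : K →ᵇ ℝ)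
    {φ : Euc n → ℝ} (h : ∀ y : K, φ y.1 = f y) : φ ∈ Xi K x.1 ↔ f ∈ SS hK x := by
  have hc : ContinuousOn φ K := by
    rw [continuousOn_iff_continuous_domRestrict]
    have : K.domRestrict φ = f := funext h
    rw [this]; exact f.continuous
  have h2 := cstar_eq hK _ (cstar_eq hK f h)
  constructor
  · rintro ⟨-, h0, h1⟩
    refine ⟨by rw [← h, h0], ?_⟩
    ext y
    rw [← h2, h1 _ y.2, h]
  · rintro ⟨h0, h1⟩
    refine ⟨hc, by rw [h, h0], fun y hy => ?_⟩
    rw [h2 ⟨y, hy⟩, h1]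
    exact (h ⟨y, hy⟩).symm

lemma SS_nonempty {n : ℕ} {K : Set (Euc n)} (hK : IsCompact K) (x : K) : (SS hK x).Nonempty := by
  have h : TT hK 0 = 0 := by
    ext y
    rw [TT_apply]
    have : Nonempty K := ⟨x⟩
    apply le_antisymm
    · refine (ciInf_le (aux_bdd 0 _) y).trans ?_
      simp
    · refine le_ciInf fun z => ?_
      simp
  exact ⟨0, rfl, by rw [h, h]⟩

/-- For Borel probability measures `μ, ν` on a compact set `K`, the
supremum of `J(φ) = ∫ φ dμ + ∫ φ* dν` over `φ ∈ Ξ` is achieved. -/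
theorem statement8 {n : ℕ} (K : Set (Euc n)) (hK : IsCompact K)
    (xstar : Euc n) (hxstar : xstar ∈ K)
    (μ ν : Measure (Euc n)) (hμ : IsProbabilityMeasure μ) (hν : IsProbabilityMeasure ν)
    (hμK : μ Kᶜ = 0) (hνK : ν Kᶜ = 0) :
    ∃ φ ∈ Xi K xstar, Jfun K μ ν φ = ⨆ ψ : Xi K xstar, Jfun K μ ν ψ.1 := by
  have : CompactSpace K := isCompact_iff_compactSpace.1 hK
  let x : K := ⟨xstar, hxstar⟩
  have fm : ∀ m : Measure (Euc n), IsFiniteMeasure m →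
      IsFiniteMeasure (m.comap ((↑) : K → Euc n)) := fun m hm => by
    refine ⟨?_⟩
    rw [comap_subtype_coe_apply hK.measurableSet]
    exact measure_lt_top _ _
  have := fm μ inferInstance
  have := fm ν inferInstance
  have hJ : Continuous (JJ hK μ ν) :=
    (int_cont _).add ((int_cont _).comp (TT_continuous hK))
  obtain ⟨f, hf, hmax⟩ := (SS_compact hK x).exists_isMaxOn (SS_nonempty hK x) hJ.continuousOn
  have hext : ∀ y : K, Function.extend ((↑) : K → Euc n) f 0 y.1 = f y :=
    fun y => Subtype.val_injective.extend_apply _ _ _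
  have hmem := (Xi_iff hK x f hext).2 hf
  refine ⟨_, hmem, ?_⟩
  have hle : ∀ ψ : Xi K xstar, Jfun K μ ν ψ.1 ≤
      Jfun K μ ν (Function.extend ((↑) : K → Euc n) f 0) := by
    intro ψ
    let g : K →ᵇ ℝ := BoundedContinuousFunction.mkOfCompact
      ⟨K.domRestrict ψ.1, continuousOn_iff_continuous_domRestrict.1 ψ.2.1⟩
    have hg : ∀ y : K, ψ.1 y.1 = g y := fun y => rfl
    rw [Jfun_eq hK μ ν g hg, Jfun_eq hK μ ν f hext]
    exact hmax ((Xi_iff hK x g hg).1 ψ.2)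
  have : Nonempty (Xi K xstar) := ⟨⟨_, hmem⟩⟩
  apply le_antisymm
  · exact le_ciSup (f := fun ψ : Xi K xstar => Jfun K μ ν ψ.1)
      ⟨_, by rintro _ ⟨ψ, rfl⟩; exact hle ψ⟩ ⟨_, hmem⟩
  · exact ciSup_le hle
end
end

section
/- (Minimax identity for the Hamiltonians.) Let X ⊆ ℝ^a and Z ⊆ ℝ^b be compact sets, let D_X ⊆ Δ(X) and D_Z ⊆ Δ(Z) be nonempty convex compact (for the weak topology) sets of probability measures, let φ : X×Z → ℝ be continuous, let μ be a finite Borel measure on X×Z, and let t ∈ (0,1]. Then inf_{x∈D_X} sup_{z∈D_Z} (1/t)∫φ d(x⊗z − μ) = sup_{z∈D_Z} inf_{x∈D_X} (1/t)∫φ d(x⊗z − μ); that is, ℋ⁺(t,μ,φ) = ℋ⁻(t,μ,φ). -/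
open MeasureTheory Set

noncomputable section

/-- The upper Hamiltonian `ℋ⁺(t,μ,φ) = inf_{x ∈ D_X} sup_{z ∈ D_Z} (1/t) ∫ φ d(x⊗z − μ)`. -/
def Hplus {a b : ℕ} (DX : Set (Measure (Euc a))) (DZ : Set (Measure (Euc b)))
    (t : ℝ) (μ : Measure (Euc a × Euc b)) (φ : Euc a × Euc b → ℝ) : ℝ :=
  ⨅ x : DX, ⨆ z : DZ, (1 / t) * ((∫ p, φ p ∂(x.1.prod z.1)) - ∫ p, φ p ∂μ)

/-- The lower Hamiltonian `ℋ⁻(t,μ,φ) = sup_{z ∈ D_Z} inf_{x ∈ D_X} (1/t) ∫ φ d(x⊗z − μ)`. -/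
def Hminus {a b : ℕ} (DX : Set (Measure (Euc a))) (DZ : Set (Measure (Euc b)))
    (t : ℝ) (μ : Measure (Euc a × Euc b)) (φ : Euc a × Euc b → ℝ) : ℝ :=
  ⨆ z : DZ, ⨅ x : DX, (1 / t) * ((∫ p, φ p ∂(x.1.prod z.1)) - ∫ p, φ p ∂μ)

theorem saddle_abs {α β : Type*} [TopologicalSpace α] [TopologicalSpace β]
    [CompactSpace α] [CompactSpace β] [Nonempty α] [Nonempty β] (B : α → β → ℝ)
    (hc1 : ∀ z, Continuous fun x => B x z) (hc2 : ∀ x, Continuous fun z => B x z)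
    (hv1 : ∀ x x' : α, ∀ s t : ℝ, 0 ≤ s → 0 ≤ t → s + t = 1 →
      ∃ y, ∀ z, B y z = s * B x z + t * B x' z)
    (hv2 : ∀ z z' : β, ∀ s t : ℝ, 0 ≤ s → 0 ≤ t → s + t = 1 →
      ∃ y, ∀ x, B x y = s * B x z + t * B x z') :
    ∃ a b, ∀ x z, B a z ≤ B x b := by
  let U : α → (β → ℝ) := B
  let V : β → (α → ℝ) := fun z x => B x z
  let f : (β → ℝ) → (α → ℝ) → ℝ := fun u v => v (Function.invFun U u)
  have hf : ∀ x z, f (U x) (V z) = B x z := by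
    intro x z
    have h : U (Function.invFun U (U x)) = U x := Function.invFun_eq ⟨x, rfl⟩
    exact congrFun h z
  have cU : Convex ℝ (range U) := by
    rintro _ ⟨x, rfl⟩ _ ⟨x', rfl⟩ s t hs ht hst
    obtain ⟨y, hy⟩ := hv1 x x' s t hs ht hst
    exact ⟨y, by funext z; simpa [U] using hy z⟩
  have cV : Convex ℝ (range V) := by
    rintro _ ⟨x, rfl⟩ _ ⟨x', rfl⟩ s t hs ht hst
    obtain ⟨y, hy⟩ := hv2 x x' s t hs ht hst
    exact ⟨y, by funext z; simpa [V] using hy z⟩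
  have kU : IsCompact (range U) := isCompact_range (continuous_pi hc1)
  have kV : IsCompact (range V) := isCompact_range (continuous_pi hc2)
  have e1 : ∀ z, EqOn (fun u => f u (V z)) (fun u => u z) (range U) := by
    rintro z _ ⟨x, rfl⟩
    exact hf x z
  have e2 : ∀ x, EqOn (fun v => f (U x) v) (fun v => v x) (range V) := by
    rintro x _ ⟨z, rfl⟩
    exact hf x z
  obtain ⟨_, ⟨a, rfl⟩, _, ⟨b, rfl⟩, h⟩ := Sion.exists_isSaddlePointOn
    (X := range U) (Y := range V) (f := f) (range_nonempty U) cU kU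
    (by
      rintro _ ⟨z, rfl⟩
      exact ((continuous_apply z).continuousOn.congr (e1 z)).lowerSemicontinuousOn)
    (by
      rintro _ ⟨z, rfl⟩
      exact (((LinearMap.proj (R := ℝ) (φ := fun _ : β => ℝ) z).convexOn cU).congr
        (fun u hu => (e1 z hu).symm)).quasiconvexOn)
    cV (range_nonempty V) kV
    (by
      rintro _ ⟨x, rfl⟩
      exact ((continuous_apply x).continuousOn.congr (e2 x)).upperSemicontinuousOn)
    (by
      rintro _ ⟨x, rfl⟩
      exact (((LinearMap.proj (R := ℝ) (φ := fun _ : α => ℝ) x).concaveOn cV).congr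
        (fun u hu => (e2 x hu).symm)).quasiconcaveOn)
  refine ⟨a, b, fun x z => ?_⟩
  have := h (U x) ⟨x, rfl⟩ (V z) ⟨z, rfl⟩
  rwa [hf, hf] at this

theorem minimax_of_saddle {α β : Type*} (G : α → β → ℝ) (C : ℝ) (hC : ∀ x z, |G x z| ≤ C)
    (a : α) (b : β) (h : ∀ x z, G a z ≤ G x b) :
    (⨅ x, ⨆ z, G x z) = ⨆ z, ⨅ x, G x z := by
  haveI : Nonempty α := ⟨a⟩
  haveI : Nonempty β := ⟨b⟩
  have b1 : ∀ x, BddAbove (range fun z => G x z) := fun x =>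
    ⟨C, by rintro _ ⟨z, rfl⟩; exact (abs_le.1 (hC x z)).2⟩
  have b2 : ∀ z, BddBelow (range fun x => G x z) := fun z =>
    ⟨-C, by rintro _ ⟨x, rfl⟩; exact (abs_le.1 (hC x z)).1⟩
  have b3 : BddBelow (range fun x => ⨆ z, G x z) :=
    ⟨-C, by rintro _ ⟨x, rfl⟩; exact (abs_le.1 (hC x b)).1.trans (le_ciSup (b1 x) b)⟩
  have b4 : BddAbove (range fun z => ⨅ x, G x z) :=
    ⟨C, by rintro _ ⟨z, rfl⟩; exact (ciInf_le (b2 z) a).trans (abs_le.1 (hC a z)).2⟩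
  apply le_antisymm
  · calc (⨅ x, ⨆ z, G x z) ≤ ⨆ z, G a z := ciInf_le b3 a
      _ ≤ G a b := ciSup_le fun z => h a z
      _ ≤ ⨅ x, G x b := le_ciInf fun x => h x b
      _ ≤ _ := le_ciSup b4 b
  · exact ciSup_le fun z => le_ciInf fun x => (ciInf_le (b2 z) x).trans (le_ciSup (b1 x) z)

/-- **Minimax identity for the Hamiltonians.** For nonempty convex compact
(w.r.t. the weak topology) sets `D_X ⊆ Δ(X)`, `D_Z ⊆ Δ(Z)` of probability measures on
compact sets `X`, `Z`, a continuous `φ`, a finite Borel measure `μ` and `t ∈ (0,1]`,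
`ℋ⁺(t,μ,φ) = ℋ⁻(t,μ,φ)`. -/
theorem statement13 {a b : ℕ} (X : Set (Euc a)) (Z : Set (Euc b))
    (hXc : IsCompact X) (hZc : IsCompact Z)
    (DX : Set (Measure (Euc a))) (DZ : Set (Measure (Euc b)))
    (hDXprob : ∀ μ ∈ DX, IsProbabilityMeasure μ) (hDXsupp : ∀ μ ∈ DX, μ Xᶜ = 0)
    (hDXne : DX.Nonempty)
    (hDXconv : ∀ μ ∈ DX, ∀ ν ∈ DX, ∀ s ∈ Icc (0 : ℝ) 1,
      ENNReal.ofReal s • μ + ENNReal.ofReal (1 - s) • ν ∈ DX)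
    (hDXcomp : IsCompact {q : ProbabilityMeasure (Euc a) | (q : Measure (Euc a)) ∈ DX})
    (hDZprob : ∀ μ ∈ DZ, IsProbabilityMeasure μ) (hDZsupp : ∀ μ ∈ DZ, μ Zᶜ = 0)
    (hDZne : DZ.Nonempty)
    (hDZconv : ∀ μ ∈ DZ, ∀ ν ∈ DZ, ∀ s ∈ Icc (0 : ℝ) 1,
      ENNReal.ofReal s • μ + ENNReal.ofReal (1 - s) • ν ∈ DZ)
    (hDZcomp : IsCompact {q : ProbabilityMeasure (Euc b) | (q : Measure (Euc b)) ∈ DZ})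
    (φ : Euc a × Euc b → ℝ) (hφ : Continuous φ)
    (μ : Measure (Euc a × Euc b)) (hμ : IsFiniteMeasure μ)
    (t : ℝ) (ht : t ∈ Ioc (0 : ℝ) 1) :
    Hplus DX DZ t μ φ = Hminus DX DZ t μ φ := by
  classical
  -- a bounded replacement of the integrand
  obtain ⟨M, hM⟩ := (hXc.prod hZc).exists_bound_of_continuousOn hφ.continuousOn
  let ψ : BoundedContinuousFunction (Euc a × Euc b) ℝ :=
    BoundedContinuousFunction.ofNormedAddCommGroup (fun p => max (-|M|) (min |M| (φ p)))
      (by fun_prop) |M| (by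
        intro p
        rw [Real.norm_eq_abs, abs_le]
        have := abs_nonneg M
        exact ⟨le_max_left _ _, max_le (by linarith) (min_le_left _ _)⟩)
  have hψ : ∀ p ∈ X ×ˢ Z, φ p = ψ p := by
    intro p hp
    have h1 := (hM p hp).trans (le_abs_self M)
    rw [Real.norm_eq_abs, abs_le] at h1
    change φ p = max (-|M|) (min |M| (φ p))
    rw [min_eq_right h1.2, max_eq_right h1.1]
  have hint : ∀ x ∈ DX, ∀ z ∈ DZ, ∫ p, φ p ∂(x.prod z) = ∫ p, ψ p ∂(x.prod z) := by
    intro x hx z hz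
    haveI := hDXprob x hx
    haveI := hDZprob z hz
    apply integral_congr_ae
    have h1 : ∀ᵐ p ∂(x.prod z), p.1 ∈ X :=
      Measure.quasiMeasurePreserving_fst.ae (show ∀ᵐ q ∂x, q ∈ X from hDXsupp x hx)
    have h2 : ∀ᵐ p ∂(x.prod z), p.2 ∈ Z :=
      Measure.quasiMeasurePreserving_snd.ae (show ∀ᵐ q ∂z, q ∈ Z from hDZsupp z hz)
    filter_upwards [h1, h2] with p hp1 hp2 using hψ p ⟨hp1, hp2⟩
  have hbd : ∀ x ∈ DX, ∀ z ∈ DZ, |∫ p, ψ p ∂(x.prod z)| ≤ ‖ψ‖ := by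
    intro x hx z hz
    haveI := hDXprob x hx
    haveI := hDZprob z hz
    exact ψ.norm_integral_le_norm (x.prod z)
  have hI : ∀ x ∈ DX, ∀ z ∈ DZ, Integrable ψ (x.prod z) := by
    intro x hx z hz
    haveI := hDXprob x hx
    haveI := hDZprob z hz
    exact ψ.integrable _
  let PX := {q : ProbabilityMeasure (Euc a) | (q : Measure (Euc a)) ∈ DX}
  let PZ := {q : ProbabilityMeasure (Euc b) | (q : Measure (Euc b)) ∈ DZ}
  haveI : CompactSpace PX := isCompact_iff_compactSpace.1 hDXcomp
  haveI : CompactSpace PZ := isCompact_iff_compactSpace.1 hDZcomp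
  haveI : Nonempty PX := let ⟨x, hx⟩ := hDXne; ⟨⟨⟨x, hDXprob x hx⟩, hx⟩⟩
  haveI : Nonempty PZ := let ⟨x, hx⟩ := hDZne; ⟨⟨⟨x, hDZprob x hx⟩, hx⟩⟩
  let B : PX → PZ → ℝ := fun x z =>
    ∫ p, ψ p ∂((x.1 : Measure (Euc a)).prod (z.1 : Measure (Euc b)))
  have hcont : Continuous fun w : PX × PZ => B w.1 w.2 := by
    have h1 : Continuous fun w : PX × PZ => (w.1.1).prod (w.2.1) :=
      ProbabilityMeasure.continuous_prod.comp
        (show Continuous fun w : PX × PZ => (w.1.1, w.2.1) by fun_prop)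
    exact (ProbabilityMeasure.continuous_integral_boundedContinuousFunction ψ).comp h1
  obtain ⟨A, D, hAD⟩ := saddle_abs B
    (fun z => hcont.comp (show Continuous fun x : PX => (x, z) by fun_prop))
    (fun x => hcont.comp (show Continuous fun z : PZ => (x, z) by fun_prop))
    (by
      intro x x' s r hs hr hsr
      obtain rfl : r = 1 - s := by linarith
      have hm := hDXconv _ x.2 _ x'.2 s ⟨hs, by linarith⟩
      refine ⟨⟨⟨_, hDXprob _ hm⟩, hm⟩, fun z => ?_⟩
      change ∫ p, ψ p ∂(Measure.prod (_ + _) _) = _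
      rw [Measure.add_prod, Measure.prod_smul_left, Measure.prod_smul_left,
        integral_add_measure ((hI _ x.2 _ z.2).smul_measure ENNReal.ofReal_ne_top)
          ((hI _ x'.2 _ z.2).smul_measure ENNReal.ofReal_ne_top),
        integral_smul_measure, integral_smul_measure, ENNReal.toReal_ofReal hs,
        ENNReal.toReal_ofReal hr]
      rfl)
    (by
      intro z z' s r hs hr hsr
      obtain rfl : r = 1 - s := by linarith
      have hm := hDZconv _ z.2 _ z'.2 s ⟨hs, by linarith⟩
      refine ⟨⟨⟨_, hDZprob _ hm⟩, hm⟩, fun x => ?_⟩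
      change ∫ p, ψ p ∂(Measure.prod _ (_ + _)) = _
      rw [Measure.prod_add, Measure.prod_smul_right, Measure.prod_smul_right,
        integral_add_measure ((hI _ x.2 _ z.2).smul_measure ENNReal.ofReal_ne_top)
          ((hI _ x.2 _ z'.2).smul_measure ENNReal.ofReal_ne_top),
        integral_smul_measure, integral_smul_measure, ENNReal.toReal_ofReal hs,
        ENNReal.toReal_ofReal hr]
      rfl)
  have ht0 : 0 ≤ 1 / t := by
    have := ht.1
    positivity
  unfold Hplus Hminus
  refine minimax_of_saddle (α := DX) (β := DZ)
    (fun x z => (1 / t) * ((∫ p, φ p ∂(x.1.prod z.1)) - ∫ p, φ p ∂μ))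
    ((1 / t) * (‖ψ‖ + |∫ p, φ p ∂μ|)) ?_ ⟨_, A.2⟩ ⟨_, D.2⟩ ?_
  · intro x z
    rw [abs_mul, abs_of_nonneg ht0, hint _ x.2 _ z.2]
    refine mul_le_mul_of_nonneg_left ((abs_sub _ _).trans ?_) ht0
    linarith [hbd _ x.2 _ z.2]
  · intro x z
    have h := hAD ⟨⟨x.1, hDXprob _ x.2⟩, x.2⟩ ⟨⟨z.1, hDZprob _ z.2⟩, z.2⟩
    refine mul_le_mul_of_nonneg_left (sub_le_sub_right ?_ _) ht0
    rw [hint _ A.2 _ z.2, hint _ x.2 _ D.2]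
    exact h
end
end
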